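/- arXiv:math/0612367 — 2 statements merged into one kernel-verified Lean document; each statement's English description precedes it below -/
import Mathlib

section
/- (Nazarov's Turán Lemma.) Let P(t) = Σ_{k=1}^m c_k e^{2iπ r_k t} with c_k ∈ ℂ∖{0} and integers r_1 < ⋯ < r_m, and let E be a measurable subset of the circle 𝕋 = ℝ/ℤ of positive measure. Then sup_{t∈𝕋} |P(t)| ≤ (14/|E|)^{m-1} · sup_{t∈E} |P(t)|. -/
open MeasureTheory
open scoped ENNReal

noncomputable section

/-- sum of Cauchy kernels -/
def nzG (s : Multiset ℂ) (z : ℂ) : ℂ := (s.map fun v => (1 - v * z)⁻¹).sum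

/-- reflection of roots -/
def nzR (w : ℂ) : ℂ := if ‖w‖ ≤ 1 then (starRingEnd ℂ) w else w⁻¹

lemma nzG_cons (v : ℂ) (s : Multiset ℂ) (z : ℂ) : nzG (v ::ₘ s) z = (1 - v * z)⁻¹ + nzG s z := by
  simp [nzG]

lemma nzR_norm (w : ℂ) : ‖nzR w‖ ≤ 1 := by
  unfold nzR
  split_ifs with h
  · simpa using h
  · rw [norm_inv]; exact inv_le_one_of_one_le₀ (by linarith)

lemma inv_re_half {u : ℂ} (hu : ‖u‖ ≤ 1) (h : 1 - u ≠ 0) : 1 / 2 ≤ ((1 - u)⁻¹).re := by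
  rw [Complex.inv_re, div_le_div_iff₀ (by norm_num) (Complex.normSq_pos.2 h)]
  have h2 : Complex.normSq u ≤ 1 := by
    rw [Complex.normSq_eq_norm_sq]; nlinarith [norm_nonneg u]
  rw [Complex.normSq_apply] at *
  simp
  nlinarith

lemma inv_re_nonneg {u : ℂ} (hu : ‖u‖ ≤ 1) : 0 ≤ ((1 - u)⁻¹).re := by
  by_cases h : 1 - u = 0
  · simp [h]
  · linarith [inv_re_half hu h]

lemma nzG_re_nonneg (s : Multiset ℂ) (hs : ∀ v ∈ s, ‖v‖ ≤ 1) {z : ℂ} (hz : ‖z‖ ≤ 1) :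
    0 ≤ (nzG s z).re := by
  induction s using Multiset.induction with
  | empty => simp [nzG]
  | cons v s ih =>
    rw [nzG_cons, Complex.add_re]
    have h1 := ih fun v hv => hs v (Multiset.mem_cons_of_mem hv)
    have h2 : 0 ≤ ((1 - v * z)⁻¹).re := by
      apply inv_re_nonneg
      rw [norm_mul]
      exact mul_le_one₀ (hs v (Multiset.mem_cons_self _ _)) (norm_nonneg _) hz
    linarith

lemma root_term {w z : ℂ} (hz : ‖z‖ = 1) (h : z ≠ w) :
    |(z / (z - w)).re| ≤ ((1 - nzR w * z)⁻¹).re ∧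
    |1 - (z / (z - w)).re| ≤ ((1 - nzR w * z)⁻¹).re ∧
    (z / (z - w)).im = - ((1 - nzR w * z)⁻¹).im := by
  have hz0 : z ≠ 0 := by rintro rfl; simp at hz
  have hzc : z * (starRingEnd ℂ) z = 1 := by
    rw [Complex.mul_conj, Complex.normSq_eq_norm_sq, hz]; simp
  have hsub : z - w ≠ 0 := sub_ne_zero.2 h
  have hn : ‖nzR w * z‖ ≤ 1 := by rw [norm_mul, hz, mul_one]; exact nzR_norm w
  by_cases hw : ‖w‖ ≤ 1
  · have e : z / (z - w) = (starRingEnd ℂ) ((1 - nzR w * z)⁻¹) := by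
      simp only [nzR, if_pos hw, map_inv₀, map_sub, map_one, map_mul, Complex.conj_conj]
      have : z - w = z * (1 - w * (starRingEnd ℂ) z) := by
        linear_combination (-w) * hzc * (-1)
      rw [this, div_eq_mul_inv, mul_inv, ← mul_assoc, mul_inv_cancel₀ hz0, one_mul]
    have h1 : 1 - nzR w * z ≠ 0 := by
      intro h0
      rw [h0] at e
      simp [hz0, hsub] at e
    have := inv_re_half hn h1
    rw [e]
    simp only [Complex.conj_re, Complex.conj_im, and_true]
    constructor <;> rw [abs_le] <;> constructor <;> linarith
  · have hw0 : w ≠ 0 := by rintro rfl; simp at hw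
    have h1 : 1 - nzR w * z ≠ 0 := by
      simp only [nzR, if_neg hw]
      intro h0
      field_simp at h0
      exact hsub (by linear_combination -h0)
    have e : z / (z - w) = 1 - (1 - nzR w * z)⁻¹ := by
      simp only [nzR, if_neg hw] at h1 ⊢
      have h3 : 1 - w⁻¹ * z = (w - z) / w := by field_simp
      have h4 : w - z ≠ 0 := sub_ne_zero.2 h.symm
      rw [h3, inv_div]
      field_simp
      ring
    have := inv_re_half hn h1
    rw [e]
    simp only [Complex.sub_re, Complex.sub_im, Complex.one_re, Complex.one_im, zero_sub, and_true]
    constructor <;> rw [abs_le] <;> constructor <;> linarith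

lemma root_sum (R : Multiset ℂ) {z : ℂ} (hz : ‖z‖ = 1) (h : ∀ w ∈ R, z ≠ w) :
    |((R.map fun w => z / (z - w)).sum).re| ≤ (nzG (R.map nzR) z).re ∧
    |(R.card : ℝ) - ((R.map fun w => z / (z - w)).sum).re| ≤ (nzG (R.map nzR) z).re ∧
    ((R.map fun w => z / (z - w)).sum).im = - (nzG (R.map nzR) z).im := by
  induction R using Multiset.induction with
  | empty => simp [nzG]
  | cons w R ih =>
    obtain ⟨a1, a2, a3⟩ := ih fun v hv => h v (Multiset.mem_cons_of_mem hv)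
    obtain ⟨b1, b2, b3⟩ := root_term hz (h w (Multiset.mem_cons_self _ _))
    rw [Multiset.map_cons, Multiset.map_cons, nzG_cons, Multiset.sum_cons, Multiset.card_cons]
    simp only [Complex.add_re, Complex.add_im]
    push_cast
    rw [abs_le] at *
    refine ⟨⟨by linarith, by linarith⟩, ?_, by linarith⟩
    rw [abs_le] at *
    constructor <;> linarith

lemma norm_le_of_re_im {x y : ℂ} (h1 : |x.re| ≤ y.re) (h2 : |x.im| = |y.im|) : ‖x‖ ≤ ‖y‖ := by
  rw [Complex.norm_def, Complex.norm_def]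
  apply Real.sqrt_le_sqrt
  rw [Complex.normSq_apply, Complex.normSq_apply]
  have h3 : x.im * x.im = y.im * y.im := by
    rw [← abs_mul_abs_self x.im, h2, abs_mul_abs_self]
  have h4 : x.re * x.re ≤ y.re * y.re := by
    rw [← abs_mul_abs_self x.re]
    exact mul_self_le_mul_self (abs_nonneg _) h1
  linarith

open Polynomial in
lemma poly_bound (p : ℂ[X]) {z : ℂ} (hz : ‖z‖ = 1) (h : p.eval z ≠ 0) :
    ‖z * p.derivative.eval z‖ ≤ ‖nzG (p.roots.map nzR) z‖ * ‖p.eval z‖ ∧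
    ‖p.natDegree * p.eval z - z * p.derivative.eval z‖ ≤
      ‖nzG (p.roots.map nzR) z‖ * ‖p.eval z‖ := by
  have hsp := IsAlgClosed.splits p
  have h1 := hsp.eval_derivative_eq_eval_mul_sum h
  have hcard : Multiset.card p.roots = p.natDegree := hsp.natDegree_eq_card_roots.symm
  obtain ⟨a1, a2, a3⟩ := root_sum p.roots hz (by
    rintro w hw rfl
    exact h (Polynomial.isRoot_of_mem_roots hw))
  have e : z * p.derivative.eval z = (p.roots.map fun w => z / (z - w)).sum * p.eval z := by
    rw [h1]
    have : (p.roots.map fun w => z / (z - w)).sum = z * (p.roots.map fun w => 1 / (z - w)).sum := by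
      rw [← Multiset.sum_map_mul_left]
      simp [div_eq_mul_inv]
    rw [this]; ring
  rw [hcard] at a2
  constructor
  · rw [e, norm_mul]
    gcongr
    exact norm_le_of_re_im a1 (by rw [a3, abs_neg])
  · rw [e, ← sub_mul, norm_mul]
    gcongr
    refine norm_le_of_re_im ?_ ?_
    · simpa using a2
    · simp [a3]

lemma nzG_measurable (s : Multiset ℂ) : Measurable (nzG s) := by
  induction s using Multiset.induction with
  | empty =>
    have : nzG 0 = fun _ => 0 := by ext; simp [nzG]
    rw [this]; exact measurable_const
  | cons v s ih =>
    have : nzG (v ::ₘ s) = fun z => (1 - v * z)⁻¹ + nzG s z := by ext z; exact nzG_cons v s z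
    rw [this]
    fun_prop

lemma nzG_analyticAt (s : Multiset ℂ) (z : ℂ) (h : ∀ v ∈ s, 1 - v * z ≠ 0) :
    AnalyticAt ℂ (nzG s) z := by
  induction s using Multiset.induction with
  | empty => 
    have : nzG 0 = fun _ => 0 := by ext; simp [nzG]
    rw [this]; exact analyticAt_const
  | cons v s ih =>
    have : nzG (v ::ₘ s) = fun z => (1 - v * z)⁻¹ + nzG s z := by ext z; exact nzG_cons v s z
    rw [this]
    have h1 := ih fun v hv => h v (Multiset.mem_cons_of_mem hv)
    have h2 := h v (Multiset.mem_cons_self _ _)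
    exact AnalyticAt.add (AnalyticAt.inv (by fun_prop) h2) h1

lemma nzG_zero (s : Multiset ℂ) : nzG s 0 = s.card := by
  simp [nzG]

/-- the logarithmic majorant -/
def nzH (s : Multiset ℂ) (a : ℝ) (t : AddCircle (1 : ℝ)) : ℝ :=
  Real.log ‖1 + a * nzG s (fourier 1 t)‖

lemma one_le_norm_nz (s : Multiset ℂ) (hs : ∀ v ∈ s, ‖v‖ ≤ 1) {a : ℝ} (ha : 0 ≤ a) {z : ℂ}
    (hz : ‖z‖ ≤ 1) : 1 ≤ ‖1 + a * nzG s z‖ := by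
  refine le_trans ?_ (Complex.re_le_norm _)
  have := mul_nonneg ha (nzG_re_nonneg s hs hz)
  simp; linarith

lemma le_norm_nz (s : Multiset ℂ) (hs : ∀ v ∈ s, ‖v‖ ≤ 1) {a : ℝ} (ha : 0 ≤ a) {z : ℂ}
    (hz : ‖z‖ ≤ 1) : a * ‖nzG s z‖ ≤ ‖1 + a * nzG s z‖ := by
  have h0 := mul_nonneg ha (nzG_re_nonneg s hs hz)
  have : a * ‖nzG s z‖ = ‖(a : ℂ) * nzG s z‖ := by
    rw [norm_mul, Complex.norm_real, Real.norm_of_nonneg ha]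
  rw [this]
  rw [Complex.norm_def, Complex.norm_def]
  apply Real.sqrt_le_sqrt
  rw [Complex.normSq_apply, Complex.normSq_apply]
  simp
  nlinarith

lemma norm_fourier_one (t : AddCircle (1 : ℝ)) (n : ℤ) : ‖fourier n t‖ = 1 := by
  rw [fourier_apply]; exact Circle.norm_coe _

lemma integral_circle (f : ℂ → ℝ) :
    ∫ t : AddCircle (1 : ℝ), f (fourier 1 t) = Real.circleAverage f 0 1 := by
  have h := AddCircle.intervalIntegral_preimage 1 0 (fun t : AddCircle (1 : ℝ) => f (fourier 1 t))
  rw [← h, Real.circleAverage_def]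
  have h2 := intervalIntegral.integral_comp_mul_right (a := 0) (b := 1)
    (fun θ => f (circleMap 0 1 θ)) (c := 2 * Real.pi) (by positivity)
  simp only [zero_mul, one_mul] at h2
  rw [← h2]
  simp only [zero_add]
  congr 1
  ext x
  congr 1
  rw [fourier_coe_apply]
  simp only [circleMap]
  push_cast
  simp
  congr 1; ring

lemma log_integral_lt (s : Multiset ℂ) (hs : ∀ v ∈ s, ‖v‖ < 1) {a : ℝ} (ha : 0 ≤ a) :
    ∫⁻ t, ENNReal.ofReal (nzH s a t) = ENNReal.ofReal (Real.log (1 + a * s.card)) := by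
  have han : AnalyticOnNhd ℂ (fun z => 1 + a * nzG s z) (Metric.closedBall 0 |1|) := by
    intro z hz
    have hz1 : ‖z‖ ≤ 1 := by simpa using hz
    have := nzG_analyticAt s z (by
      intro v hv h0
      have h1 : ‖v * z‖ < 1 := by
        rw [norm_mul]
        nlinarith [hs v hv, norm_nonneg v, norm_nonneg z]
      rw [← sub_eq_zero.1 h0] at h1
      simp at h1)
    fun_prop
  have hne : ∀ z, ‖z‖ ≤ 1 → (1 + a * nzG s z) ≠ 0 := by
    intro z hz h0
    have := one_le_norm_nz s (fun v hv => (hs v hv).le) ha hz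
    rw [h0] at this; norm_num at this
  have hav := han.circleAverage_log_norm_of_ne_zero (by
    intro z hz
    exact hne z (by simpa using hz))
  have hcont : Continuous (nzH s a) := by
    unfold nzH
    have h1 : Continuous fun t : AddCircle (1 : ℝ) => (1 + a * nzG s (fourier 1 t)) := by
      have := han.continuousOn.comp_continuous (f := fun t : AddCircle (1 : ℝ) => (fourier 1 t : ℂ))
        (by fun_prop) (by intro t; simpa only [abs_one, mem_closedBall_zero_iff] using (norm_fourier_one t 1).le)
      exact this
    exact h1.norm.log (fun t => norm_ne_zero_iff.2 (hne _ (norm_fourier_one t 1).le))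
  rw [← ofReal_integral_eq_lintegral_ofReal]
  · congr 1
    have := integral_circle (fun z => Real.log ‖1 + a * nzG s z‖)
    unfold nzH
    rw [this, hav, nzG_zero]
    congr 1
    rw [← Complex.norm_of_nonneg (show 0 ≤ 1 + a * (s.card : ℝ) by positivity)]
    push_cast; rfl
  · exact hcont.integrable_of_hasCompactSupport (HasCompactSupport.of_compactSpace _)
  · refine Filter.Eventually.of_forall fun t => ?_
    exact Real.log_nonneg (one_le_norm_nz s (fun v hv => (hs v hv).le) ha (norm_fourier_one t 1).le)

lemma ae_fourier_ne (ζ : ℂ) : ∀ᵐ t : AddCircle (1 : ℝ), (fourier 1 t : ℂ) ≠ ζ := by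
  have hsub : Set.Subsingleton {t : AddCircle (1 : ℝ) | (fourier 1 t : ℂ) = ζ} := by
    intro x hx y hy
    have : (fourier 1 x : ℂ) = fourier 1 y := by rw [hx, hy]
    simp only [fourier_one] at this
    exact AddCircle.injective_toCircle one_ne_zero (Subtype.ext this)
  have : volume {t : AddCircle (1 : ℝ) | (fourier 1 t : ℂ) = ζ} = 0 := by
    rcases hsub.eq_empty_or_singleton with h | ⟨x, h⟩
    · rw [h]; simp
    · rw [h]
      have := AddCircle.volume_closedBall (T := 1) (x := x) 0
      simpa using this
  rw [ae_iff]
  simpa only [ne_eq, not_not] using this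

lemma ae_fourier_ne_multiset (s : Multiset ℂ) :
    ∀ᵐ t : AddCircle (1 : ℝ), ∀ ζ ∈ s, (fourier 1 t : ℂ) ≠ ζ := by
  induction s using Multiset.induction with
  | empty => simp
  | cons v s ih =>
    filter_upwards [ih, ae_fourier_ne v] with t h1 h2 ζ hζ
    rcases Multiset.mem_cons.1 hζ with rfl | h
    · exact h2
    · exact h1 _ h

lemma nzH_measurable (s : Multiset ℂ) (a : ℝ) : Measurable (nzH s a) := by
  unfold nzH
  have h0 : Measurable fun t : AddCircle (1 : ℝ) => (fourier 1 t : ℂ) :=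
    (by fun_prop : Continuous fun t : AddCircle (1 : ℝ) => (fourier 1 t : ℂ)).measurable
  have := (nzG_measurable s).comp h0
  exact Real.measurable_log.comp ((measurable_const.add (measurable_const.mul this)).norm)

lemma nzG_scale (s : Multiset ℂ) (r z : ℂ) : nzG (s.map (r * ·)) z = nzG s (r * z) := by
  simp only [nzG, Multiset.map_map, Function.comp_def]
  congr 1
  apply Multiset.map_congr rfl
  intro v _
  congr 2; ring

lemma log_integral_le (s : Multiset ℂ) (hs : ∀ v ∈ s, ‖v‖ ≤ 1) {a : ℝ} (ha : 0 ≤ a) :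
    ∫⁻ t, ENNReal.ofReal (nzH s a t) ≤ ENNReal.ofReal (Real.log (1 + a * s.card)) := by
  let r : ℕ → ℂ := fun n => ((n / (n + 1 : ℝ) : ℝ) : ℂ)
  have hr : Filter.Tendsto r Filter.atTop (nhds 1) := by
    have := tendsto_natCast_div_add_atTop (1 : ℝ)
    have h2 := (Complex.continuous_ofReal.tendsto 1).comp this
    simpa [r, Function.comp_def] using h2
  have hr1 : ∀ n, ‖r n‖ < 1 := by
    intro n
    simp only [r, Complex.norm_real]
    rw [Real.norm_of_nonneg (by positivity), div_lt_one (by positivity)]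
    linarith
  let F : ℕ → AddCircle (1 : ℝ) → ℝ≥0∞ := fun n t => ENNReal.ofReal (nzH (s.map (r n * ·)) a t)
  have hF : ∀ n, Measurable (F n) := fun n => (nzH_measurable _ _).ennreal_ofReal
  have hint : ∀ n, ∫⁻ t, F n t = ENNReal.ofReal (Real.log (1 + a * s.card)) := by
    intro n
    have := log_integral_lt (s.map (r n * ·)) (by
      intro v hv
      obtain ⟨w, hw, rfl⟩ := Multiset.mem_map.1 hv
      rw [norm_mul]
      nlinarith [hr1 n, hs w hw, norm_nonneg w, norm_nonneg (r n)]) ha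
    rw [Multiset.card_map] at this
    exact this
  have hlim : ∀ᵐ t, ENNReal.ofReal (nzH s a t) = Filter.liminf (fun n => F n t) Filter.atTop := by
    filter_upwards [ae_fourier_ne_multiset (s.map (·⁻¹))] with t ht
    symm
    apply Filter.Tendsto.liminf_eq
    apply ENNReal.tendsto_ofReal
    simp only [nzH, nzG_scale]
    set z : ℂ := fourier 1 t with hz
    have hc : ContinuousAt (nzG s) z := (nzG_analyticAt s z (by
      intro v hv h0
      apply ht v⁻¹ (Multiset.mem_map_of_mem _ hv)
      exact (eq_inv_of_mul_eq_one_right (sub_eq_zero.1 h0).symm))).continuousAt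
    have h1 : Filter.Tendsto (fun n => r n * z) Filter.atTop (nhds z) := by
      simpa using hr.mul_const z
    have h2 := hc.tendsto.comp h1
    have h3 := ((h2.const_mul (a : ℂ)).const_add 1).norm
    refine h3.log ?_
    have := one_le_norm_nz s hs ha (z := z) (norm_fourier_one t 1).le
    linarith
  rw [lintegral_congr_ae hlim]
  refine (lintegral_liminf_le hF).trans ?_
  simp [hint]

lemma fourier_split (t : AddCircle (1 : ℝ)) (a k : ℤ) (e : ℕ) (h : (e : ℤ) = k - a) :
    (fourier k t : ℂ) = fourier a t * (fourier 1 t) ^ e := by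
  have hk : k = a + e := by omega
  subst hk
  rw [fourier_add]
  congr 1
  rw [fourier_apply, fourier_one, AddCircle.toCircle_zsmul]
  simp

open Polynomial in
lemma reduction_step (S : Finset ℤ) (hS : 2 ≤ S.card) (c : ℤ → ℂ) (hc : ∀ k ∈ S, c k ≠ 0)
    (τ : ℝ) (hτ : 0 < τ) :
    ∃ (d : ℤ → ℝ) (x : ℤ) (h : AddCircle (1 : ℝ) → ℝ), x ∈ S ∧ d x = 0 ∧
      (∀ k ∈ S, k ≠ x → 0 < d k) ∧
      (∑ k ∈ S, ‖c k‖ ≤ 2 * ∑ k ∈ S, d k * ‖c k‖) ∧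
      Measurable h ∧ (∀ t, 0 ≤ h t) ∧
      (∫⁻ t, ENNReal.ofReal (h t) ≤ ENNReal.ofReal (1 / τ)) ∧
      ∀ᵐ t, ‖∑ k ∈ S, (d k * c k) * fourier k t‖ ≤
        τ * Real.exp (h t) * ‖∑ k ∈ S, c k * fourier k t‖ := by
  have hne : S.Nonempty := Finset.card_pos.1 (by omega)
  set a := S.min' hne with ha
  set b := S.max' hne with hb
  have haS : a ∈ S := S.min'_mem hne
  have hbS : b ∈ S := S.max'_mem hne
  have hab : a < b := S.min'_lt_max'_of_card (by omega)
  let e : ℤ → ℕ := fun k => (k - a).toNat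
  have he : ∀ k ∈ S, (e k : ℤ) = k - a := by
    intro k hk
    have := S.min'_le k hk
    simp only [e]; omega
  set N := e b with hN
  have hNb : (N : ℤ) = b - a := he b hbS
  have hN0 : 0 < N := by omega
  have heN : ∀ k ∈ S, e k ≤ N := by
    intro k hk
    have h1 := S.le_max' k hk
    have h2 := he k hk
    omega
  let p : ℂ[X] := ∑ k ∈ S, C (c k) * X ^ (e k)
  have hcoef : p.coeff N = c b := by
    simp only [p, finsetSum_coeff, coeff_C_mul, coeff_X_pow]
    rw [Finset.sum_eq_single b]
    · simp [hN]
    · intro k hk hkb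
      have : N ≠ e k := by
        intro h
        have := he k hk
        omega
      simp [this]
    · intro h; exact absurd hbS h
  have hdeg : p.natDegree = N := by
    apply natDegree_eq_of_le_of_coeff_ne_zero
    · apply natDegree_sum_le_of_forall_le
      intro k hk
      exact (natDegree_C_mul_X_pow_le _ _).trans (heN k hk)
    · rw [hcoef]; exact hc b hbS
  have hp0 : p ≠ 0 := by
    intro h; rw [h] at hdeg; simp at hdeg; omega
  have hev : ∀ z, p.eval z = ∑ k ∈ S, c k * z ^ (e k) := by
    intro z; simp [p, eval_finsetSum]
  have hder : ∀ z, z * p.derivative.eval z = ∑ k ∈ S, (e k) * (c k * z ^ (e k)) := by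
    intro z
    simp only [p, derivative_sum, eval_finsetSum, Finset.mul_sum]
    apply Finset.sum_congr rfl
    intro k _
    rw [derivative_C_mul_X_pow]
    rcases Nat.eq_zero_or_pos (e k) with h | h
    · simp [h]
    · obtain ⟨m, hm⟩ := Nat.exists_eq_succ_of_ne_zero h.ne'
      rw [hm]
      simp [pow_succ]
      ring
  let s : Multiset ℂ := p.roots.map nzR
  have hs : ∀ v ∈ s, ‖v‖ ≤ 1 := by
    intro v hv
    obtain ⟨w, _, rfl⟩ := Multiset.mem_map.1 hv
    exact nzR_norm w
  have hcard : s.card = N := by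
    simp only [s, Multiset.card_map]
    rw [← hdeg]; exact (IsAlgClosed.splits p).natDegree_eq_card_roots.symm
  have hNR : (0 : ℝ) < N := by exact_mod_cast hN0
  have hNC : (N : ℂ) ≠ 0 := by exact_mod_cast hN0.ne'
  have hmul : ∀ y : ℂ, (N : ℝ) * ‖y‖ = ‖(N : ℂ) * y‖ := by
    intro y; rw [norm_mul, Complex.norm_natCast]
  let α : ℝ := 1 / (N * τ)
  have hα : 0 ≤ α := by positivity
  have hmain : ∃ (d : ℤ → ℝ) (x : ℤ), x ∈ S ∧ d x = 0 ∧ (∀ k ∈ S, k ≠ x → 0 < d k) ∧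
      (∑ k ∈ S, ‖c k‖ ≤ 2 * ∑ k ∈ S, d k * ‖c k‖) ∧
      ∀ z : ℂ, ‖z‖ = 1 → p.eval z ≠ 0 →
        N * ‖∑ k ∈ S, (d k * c k) * z ^ (e k)‖ ≤ ‖nzG s z‖ * ‖p.eval z‖ := by
    have hsum : ∑ k ∈ S, ((e k : ℝ) / N) * ‖c k‖ + ∑ k ∈ S, (1 - (e k : ℝ) / N) * ‖c k‖
        = ∑ k ∈ S, ‖c k‖ := by
      rw [← Finset.sum_add_distrib]
      apply Finset.sum_congr rfl
      intro k _; ring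
    by_cases hW : ∑ k ∈ S, ‖c k‖ ≤ 2 * ∑ k ∈ S, ((e k : ℝ) / N) * ‖c k‖
    · refine ⟨fun k => (e k : ℝ) / N, a, haS, ?_, ?_, hW, ?_⟩
      · simp [e]
      · intro k hk hka
        have h1 := S.min'_le k hk
        have h2 := he k hk
        have : 0 < e k := by omega
        positivity
      · intro z hz hpz
        refine le_trans (le_of_eq ?_) (poly_bound p hz hpz).1
        rw [hder]
        rw [hmul, Finset.mul_sum]
        congr 1
        apply Finset.sum_congr rfl
        intro k _
        push_cast
        field_simp
    · refine ⟨fun k => 1 - (e k : ℝ) / N, b, hbS, ?_, ?_, by linarith, ?_⟩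
      · simp [← hN, hNR.ne']
      · intro k hk hkb
        have h2 := he k hk
        have h3 := heN k hk
        have : e k < N := by omega
        have : (e k : ℝ) / N < 1 := by
          rw [div_lt_one hNR]; exact_mod_cast this
        show 0 < 1 - (e k : ℝ) / N
        linarith
      · intro z hz hpz
        refine le_trans (le_of_eq ?_) (poly_bound p hz hpz).2
        rw [hder, hdeg, hev]
        rw [hmul, Finset.mul_sum, Finset.mul_sum, ← Finset.sum_sub_distrib]
        congr 1
        apply Finset.sum_congr rfl
        intro k _
        push_cast
        field_simp
  obtain ⟨d, x, hxS, hdx, hdpos, hW, hbound⟩ := hmain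
  refine ⟨d, x, nzH s α, hxS, hdx, hdpos, hW, nzH_measurable _ _, ?_, ?_, ?_⟩
  · intro t
    exact Real.log_nonneg (one_le_norm_nz s hs hα (norm_fourier_one t 1).le)
  · refine (log_integral_le s hs hα).trans (ENNReal.ofReal_le_ofReal ?_)
    have h1 : α * (s.card : ℝ) = 1 / τ := by
      rw [hcard]; simp only [α]; field_simp
    rw [h1]
    have h2 : 0 < 1 / τ := by positivity
    have := Real.log_le_sub_one_of_pos (show 0 < 1 + 1 / τ by positivity)
    linarith
  · filter_upwards [ae_fourier_ne_multiset p.roots] with t ht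
    set z : ℂ := fourier 1 t with hz
    have hz1 : ‖z‖ = 1 := norm_fourier_one t 1
    have hpz : p.eval z ≠ 0 := by
      intro h0
      exact ht z ((mem_roots hp0).2 h0) rfl
    have hfac : ∀ f : ℤ → ℂ, ‖∑ k ∈ S, f k * fourier k t‖ = ‖∑ k ∈ S, f k * z ^ (e k)‖ := by
      intro f
      have : ∑ k ∈ S, f k * fourier k t = fourier a t * ∑ k ∈ S, f k * z ^ (e k) := by
        rw [Finset.mul_sum]
        apply Finset.sum_congr rfl
        intro k hk
        rw [fourier_split t a k (e k) (he k hk)]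
        ring
      rw [this, norm_mul, norm_fourier_one, one_mul]
    rw [hfac (fun k => d k * c k), hfac c, ← hev]
    have h1 := hbound z hz1 hpz
    have h2 := le_norm_nz s hs hα hz1.le
    have h3 : Real.exp (nzH s α t) = ‖1 + α * nzG s z‖ := by
      unfold nzH
      exact Real.exp_log (lt_of_lt_of_le one_pos (one_le_norm_nz s hs hα hz1.le))
    rw [h3]
    have h4 : ‖nzG s z‖ ≤ N * (τ * ‖1 + α * nzG s z‖) := by
      have : ‖nzG s z‖ = N * (τ * (α * ‖nzG s z‖)) := by
        simp only [α]; field_simp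
      rw [this]
      gcongr
    have h5 : N * ‖∑ k ∈ S, (d k * c k) * z ^ (e k)‖ ≤
        N * (τ * ‖1 + α * nzG s z‖ * ‖p.eval z‖) := by
      refine h1.trans ?_
      calc _ ≤ (N * (τ * ‖1 + α * nzG s z‖)) * ‖p.eval z‖ := by gcongr
        _ = _ := by ring
    exact le_of_mul_le_mul_left h5 hNR

lemma main_induction (n : ℕ) (τ : ℝ) (hτ : 0 < τ) : ∀ (S : Finset ℤ) (c : ℤ → ℂ),
    S.card = n + 1 → (∀ k ∈ S, c k ≠ 0) →
    ∃ H : AddCircle (1 : ℝ) → ℝ, Measurable H ∧ (∀ t, 0 ≤ H t) ∧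
      (∫⁻ t, ENNReal.ofReal (H t) ≤ ENNReal.ofReal (n / τ)) ∧
      ∀ᵐ t, ∑ k ∈ S, ‖c k‖ ≤
        (2 * τ) ^ n * Real.exp (H t) * ‖∑ k ∈ S, c k * fourier k t‖ := by
  induction n with
  | zero =>
    intro S c hS hc
    obtain ⟨k, rfl⟩ := Finset.card_eq_one.1 hS
    refine ⟨fun _ => 0, measurable_const, fun _ => le_rfl, by simp, ?_⟩
    refine Filter.Eventually.of_forall fun t => ?_
    simp only [Finset.sum_singleton, norm_mul, norm_fourier_one]
    simp
  | succ n ih =>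
    intro S c hS hc
    obtain ⟨d, x, h, hxS, hdx, hdpos, hW, hm, h0, hint, hae⟩ :=
      reduction_step S (by omega) c hc τ hτ
    obtain ⟨H, Hm, H0, Hint, Hae⟩ := ih (S.erase x) (fun k => d k * c k)
      (by rw [Finset.card_erase_of_mem hxS]; omega) (by
        intro k hk
        rw [Finset.mem_erase] at hk
        exact mul_ne_zero (by exact_mod_cast (hdpos k hk.2 hk.1).ne') (hc k hk.2))
    refine ⟨fun t => H t + h t, Hm.add hm, fun t => add_nonneg (H0 t) (h0 t), ?_, ?_⟩
    · simp_rw [ENNReal.ofReal_add (H0 _) (h0 _)]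
      rw [lintegral_add_left Hm.ennreal_ofReal]
      refine (add_le_add Hint hint).trans (le_of_eq ?_)
      rw [← ENNReal.ofReal_add (by positivity) (by positivity)]
      congr 1; push_cast; ring
    · filter_upwards [hae, Hae] with t h1 h2
      have e1 : ∑ k ∈ S.erase x, ‖(d k : ℂ) * c k‖ = ∑ k ∈ S, d k * ‖c k‖ := by
        rw [← Finset.sum_erase S (a := x) (by simp [hdx])]
        apply Finset.sum_congr rfl
        intro k hk
        rw [Finset.mem_erase] at hk
        rw [norm_mul, Complex.norm_real, Real.norm_of_nonneg (hdpos k hk.2 hk.1).le]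
      have e2 : ∑ k ∈ S.erase x, ((d k : ℂ) * c k) * fourier k t =
          ∑ k ∈ S, ((d k : ℂ) * c k) * fourier k t :=
        Finset.sum_erase S (by simp [hdx])
      rw [e1, e2] at h2
      calc ∑ k ∈ S, ‖c k‖ ≤ 2 * ∑ k ∈ S, d k * ‖c k‖ := hW
        _ ≤ 2 * ((2 * τ) ^ n * Real.exp (H t) *
            (τ * Real.exp (h t) * ‖∑ k ∈ S, c k * fourier k t‖)) := by
          gcongr
          exact h2.trans (by gcongr)
        _ = _ := by rw [Real.exp_add]; ring

theorem nazarov_turan (m : ℕ) (hm : 1 ≤ m) (c : Fin m → ℂ) (hc : ∀ k, c k ≠ 0)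
    (r : Fin m → ℤ) (hr : StrictMono r) (E : Set (AddCircle (1 : ℝ)))
    (hE : MeasurableSet E) (hE0 : 0 < volume E) (t : AddCircle (1 : ℝ)) :
    ‖∑ k, c k * fourier (r k) t‖ ≤
      (14 / (volume E).toReal) ^ (m - 1) *
        ⨆ s : E, ‖∑ k, c k * fourier (r k) (s : AddCircle (1 : ℝ))‖ := by
  obtain ⟨n, rfl⟩ : ∃ n, m = n + 1 := ⟨m - 1, by omega⟩
  rw [Nat.add_sub_cancel]
  set δ := (volume E).toReal with hδ
  have hfin : volume E ≠ ∞ := measure_ne_top _ _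
  have hδ0 : 0 < δ := ENNReal.toReal_pos hE0.ne' hfin
  let S : Finset ℤ := Finset.univ.image r
  let c' : ℤ → ℂ := fun k => c (Function.invFun r k)
  have hc' : ∀ k, c' (r k) = c k := fun k => by
    simp only [c', Function.leftInverse_invFun hr.injective k]
  have hsum : ∀ {M : Type} [AddCommMonoid M] (f : ℤ → M), ∑ k ∈ S, f k = ∑ k, f (r k) := by
    intro M _ f
    exact Finset.sum_image fun x _ y _ h => hr.injective h
  obtain ⟨H, Hm, H0, Hint, Hae⟩ := main_induction n δ⁻¹ (by positivity) S c'
    (by simp [S, Finset.card_image_of_injective _ hr.injective]) (fun k _ => hc _)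
  simp only [hsum, hc'] at Hae
  have hμ : volume.restrict E ≠ 0 := by
    intro h; rw [Measure.restrict_eq_zero] at h; exact hE0.ne' h
  have hN := ae_iff.1 ((ae_restrict_of_ae Hae).and (ae_restrict_mem hE))
  obtain ⟨y, hyN, hy⟩ := exists_notMem_null_le_laverage hμ
    (Hm.ennreal_ofReal.aemeasurable) hN
  simp only [Set.mem_ofPred_eq, not_not] at hyN
  obtain ⟨hy1, hyE⟩ := hyN
  have hHy : H y ≤ n := by
    rw [setLAverage_eq] at hy
    have h1 : ENNReal.ofReal (H y) ≤ ENNReal.ofReal (n * δ) / volume E := by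
      refine hy.trans ?_
      gcongr
      refine (setLIntegral_le_lintegral _ _).trans (Hint.trans (le_of_eq ?_))
      congr 1; simp
    have h2 : volume E = ENNReal.ofReal δ := (ENNReal.ofReal_toReal hfin).symm
    rw [h2, ← ENNReal.ofReal_div_of_pos hδ0, mul_div_cancel_right₀ _ hδ0.ne'] at h1
    exact (ENNReal.ofReal_le_ofReal_iff (by positivity)).1 h1
  have hle : ∀ s : AddCircle (1 : ℝ), ‖∑ k, c k * fourier (r k) s‖ ≤ ∑ k, ‖c k‖ := by
    intro s
    refine (norm_sum_le _ _).trans (le_of_eq ?_)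
    apply Finset.sum_congr rfl
    intro k _
    rw [norm_mul, norm_fourier_one, mul_one]
  have hsup : ‖∑ k, c k * fourier (r k) y‖ ≤
      ⨆ s : E, ‖∑ k, c k * fourier (r k) (s : AddCircle (1 : ℝ))‖ := by
    refine le_ciSup (f := fun s : E => ‖∑ k, c k * fourier (r k) (s : AddCircle (1 : ℝ))‖)
      ⟨∑ k, ‖c k‖, ?_⟩ ⟨y, hyE⟩
    rintro _ ⟨s, rfl⟩
    exact hle s
  refine (hle t).trans (hy1.trans ?_)
  have hexp : Real.exp (H y) ≤ 7 ^ n := by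
    calc Real.exp (H y) ≤ Real.exp n := Real.exp_le_exp.2 hHy
      _ = Real.exp 1 ^ n := by rw [← Real.exp_nat_mul, mul_one]
      _ ≤ 7 ^ n := by
        gcongr
        linarith [Real.exp_one_lt_d9]
  calc _ ≤ (2 * δ⁻¹) ^ n * 7 ^ n * ‖∑ k, c k * fourier (r k) y‖ := by gcongr
    _ = (14 / δ) ^ n * ‖∑ k, c k * fourier (r k) y‖ := by
      rw [← mul_pow]; congr 2; field_simp; norm_num
    _ ≤ _ := by gcongr
end
end

section
/- (Fontes-Merz's Turán Lemma.) Let d ≥ 1 be an integer and let p(z_1,…,z_d) = Σ_{k_1=0}^{m_1} ⋯ Σ_{k_d=0}^{m_d} c_{k_1,…,k_d} z_1^{r_{1,k_1}} ⋯ z_d^{r_{d,k_d}} be a polynomial in d variables with integer exponents r_{i,k_i} ∈ ℤ. Then for every measurable set E ⊂ 𝕋^d of positive measure, sup_{z∈𝕋^d} |p(z)| ≤ (14d/|E|)^{m_1+⋯+m_d} · sup_{z∈E} |p(z)|. -/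
open MeasureTheory
open scoped ENNReal BigOperators

noncomputable section

/-- The point of the unit circle attached to `t`. -/
def zz (t : AddCircle (1 : ℝ)) : ℂ := (AddCircle.toCircle t : ℂ)

lemma norm_zz (t : AddCircle (1 : ℝ)) : ‖zz t‖ = 1 := Circle.norm_coe _

lemma zz_ne (t : AddCircle (1 : ℝ)) : zz t ≠ 0 := by
  intro h; have := norm_zz t; rw [h] at this; simp at this

lemma continuous_zz : Continuous zz :=
  continuous_subtype_val.comp AddCircle.continuous_toCircle

lemma fourier_zz (n : ℤ) (t : AddCircle (1 : ℝ)) : fourier n t = zz t ^ n := by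
  simp [fourier_apply, zz, AddCircle.toCircle_zsmul]

lemma zz_inj : Function.Injective zz := by
  intro a b h
  exact AddCircle.injective_toCircle one_ne_zero (Subtype.ext h)

lemma noAtoms_circle (x : AddCircle (1 : ℝ)) : volume ({x} : Set (AddCircle (1 : ℝ))) = 0 := by
  have h := AddCircle.volume_closedBall (T := (1 : ℝ)) (x := x) 0
  simpa using h

instance : NullSingletonClass (volume : Measure (AddCircle (1 : ℝ))) := ⟨noAtoms_circle⟩

/-- almost every point avoids a finite set of complex numbers -/
lemma ae_avoid {S : Set ℂ} (hS : S.Finite) : ∀ᵐ t : AddCircle (1 : ℝ), zz t ∉ S := by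
  have : (zz ⁻¹' S).Finite := hS.preimage zz_inj.injOn
  have h0 : volume (zz ⁻¹' S) = 0 := this.measure_zero _
  exact (measure_eq_zero_iff_ae_notMem).1 h0

/-- Sum of Herglotz kernels -/
def SS (s : Multiset ℂ) (z : ℂ) : ℂ := (s.map (fun a => (1 + a * z) / (1 - a * z))).sum

lemma SS_zero (s : Multiset ℂ) : SS s 0 = Multiset.card s := by simp [SS]

lemma kernel_re (w : ℂ) (hw : ‖w‖ ≤ 1) : 0 ≤ ((1 + w) / (1 - w)).re := by
  rw [Complex.div_re, ← add_div]
  apply div_nonneg _ (Complex.normSq_nonneg _)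
  have h : w.re * w.re + w.im * w.im ≤ 1 := by
    rw [← Complex.normSq_apply, Complex.normSq_eq_norm_sq]
    nlinarith [norm_nonneg w]
  simp only [Complex.add_re, Complex.sub_re, Complex.add_im, Complex.sub_im, Complex.one_re,
    Complex.one_im]
  nlinarith

lemma SS_re (s : Multiset ℂ) (hs : ∀ a ∈ s, ‖a‖ ≤ 1) (z : ℂ) (hz : ‖z‖ ≤ 1) :
    0 ≤ (SS s z).re := by
  induction s using Multiset.induction with
  | empty => simp [SS]
  | cons a s ih =>
    have h1 := ih (fun b hb => hs b (Multiset.mem_cons_of_mem hb))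
    have h2 := kernel_re (a * z) (by
      rw [norm_mul]; exact mul_le_one₀ (hs a (Multiset.mem_cons_self a s)) (norm_nonneg _) hz)
    simp only [SS, Multiset.map_cons, Multiset.sum_cons, Complex.add_re] at *
    linarith

lemma SS_diff (s : Multiset ℂ) (z : ℂ) (hz : ∀ a ∈ s, 1 - a * z ≠ 0) :
    DifferentiableAt ℂ (SS s) z := by
  induction s using Multiset.induction with
  | empty => exact differentiableAt_const (0 : ℂ)
  | cons a s ih =>
    have h1 := ih (fun b hb => hz b (Multiset.mem_cons_of_mem hb))
    have h2 := hz a (Multiset.mem_cons_self a s)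
    have : SS (a ::ₘ s) = fun z => (1 + a * z) / (1 - a * z) + SS s z := by
      ext z; simp [SS]
    rw [this]
    fun_prop (disch := assumption)

lemma SS_measurable (s : Multiset ℂ) : Measurable (SS s) := by
  induction s using Multiset.induction with
  | empty => exact measurable_const (a := (0 : ℂ))
  | cons a s ih =>
    have : SS (a ::ₘ s) = fun z => (1 + a * z) / (1 - a * z) + SS s z := by
      ext z; simp [SS]
    rw [this]
    fun_prop

lemma one_sub_ne (a z : ℂ) (ha : ‖a‖ ≤ 1) (hz : ‖z‖ < 1) : 1 - a * z ≠ 0 := by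
  intro h
  have h1 : a * z = 1 := (sub_eq_zero.1 h).symm
  have h2 : ‖a * z‖ < 1 := by
    rw [norm_mul]; nlinarith [norm_nonneg a, norm_nonneg z]
  rw [h1] at h2; simp at h2

lemma add_ne (w : ℂ) (τ : ℝ) (hτ : 0 < τ) (hw : 0 ≤ w.re) : w + τ ≠ 0 := by
  intro h
  have := congrArg Complex.re h
  simp at this; linarith

lemma quot_re (w : ℂ) (τ : ℝ) (hτ : 0 < τ) (hw : 0 ≤ w.re) : 0 ≤ (w / (w + τ)).re := by
  rw [Complex.div_re, ← add_div]
  apply div_nonneg _ (Complex.normSq_nonneg _)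
  simp
  nlinarith [mul_nonneg hw hτ.le, mul_self_nonneg w.re, mul_self_nonneg w.im]

lemma quot_norm (w : ℂ) (τ : ℝ) (hτ : 0 < τ) (hw : 0 ≤ w.re) : ‖w / (w + τ)‖ ≤ 1 := by
  rw [norm_div]
  apply div_le_one_of_le₀ _ (norm_nonneg _)
  rw [← sq_le_sq₀ (norm_nonneg _) (norm_nonneg _), ← Complex.normSq_eq_norm_sq,
    ← Complex.normSq_eq_norm_sq, Complex.normSq_apply, Complex.normSq_apply]
  simp
  nlinarith

lemma quot_half (w : ℂ) (τ : ℝ) (hτ : 0 < τ) (hw : 0 ≤ w.re) (h : τ ≤ ‖w‖) :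
    1 / 2 ≤ (w / (w + τ)).re := by
  have h0 : 0 < Complex.normSq (w + τ) := Complex.normSq_pos.2 (add_ne w τ hτ hw)
  rw [Complex.div_re, ← add_div, le_div_iff₀ h0]
  have h1 : τ ^ 2 ≤ w.re * w.re + w.im * w.im := by
    rw [← Complex.normSq_apply, Complex.normSq_eq_norm_sq]
    nlinarith
  rw [Complex.normSq_apply]
  simp
  nlinarith

/-- mean value property on smaller circles -/
lemma mean_value (f : ℂ → ℂ) (hf : ∀ z, ‖z‖ < 1 → DifferentiableAt ℂ f z) (ρ : ℝ) (h0 : 0 < ρ)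
    (h1 : ρ < 1) : ∫ t : AddCircle (1 : ℝ), f (ρ * zz t) = f 0 := by
  have h2 : Real.circleAverage f 0 ρ = f 0 := by
    apply DiffContOnCl.circleAverage
    apply DifferentiableOn.diffContOnCl
    intro z hz
    apply (hf z _).differentiableWithinAt
    have := Metric.closure_ball_subset_closedBall hz
    simp at this
    rw [abs_of_pos h0] at this
    linarith
  rw [← h2, Real.circleAverage_def, ← AddCircle.intervalIntegral_preimage 1 0]
  have h3 := intervalIntegral.integral_comp_mul_left (a := 0) (b := 1)
    (fun θ => f (circleMap 0 ρ θ)) (c := 2 * Real.pi) (by positivity)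
  simp only [mul_zero, mul_one] at h3
  rw [← h3, zero_add]
  congr 1
  ext x
  simp [zz, AddCircle.toCircle_apply_mk, circleMap]

lemma weak_type_SS (s : Multiset ℂ) (hs : ∀ a ∈ s, ‖a‖ ≤ 1) (hs0 : 0 < Multiset.card s)
    (τ : ℝ) (hτ : 0 < τ) :
    volume {t : AddCircle (1 : ℝ) | τ * Multiset.card s ≤ ‖SS s (zz t)‖} ≤
      ENNReal.ofReal (2 / (1 + τ)) := by
  set K : ℝ := (Multiset.card s : ℝ) with hK
  have hK0 : 0 < K := by rw [hK]; exact_mod_cast hs0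
  have hτK : 0 < τ * K := by positivity
  set F : ℂ → ℂ := fun z => SS s z / (SS s z + (τ * K : ℝ)) with hF
  have hFm : Measurable F := by
    have := SS_measurable s
    fun_prop
  have hmean : ∀ ρ : ℝ, 0 < ρ → ρ < 1 → ∫ t : AddCircle (1 : ℝ), F (ρ * zz t) = F 0 := by
    intro ρ h0 h1
    apply mean_value F _ ρ h0 h1
    intro z hz
    have := SS_diff s z (fun a ha => one_sub_ne a z (hs a ha) hz)
    have h2 := add_ne _ _ hτK (SS_re s hs z hz.le)
    exact this.div (this.add_const _) h2
  have hF0 : F 0 = ((1 / (1 + τ) : ℝ) : ℂ) := by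
    simp only [hF, SS_zero]
    have : ((Multiset.card s : ℕ) : ℂ) = ((K : ℝ) : ℂ) := by simp [hK]
    rw [this]
    norm_cast
    field_simp
  have hlim : Filter.Tendsto (fun ρ : ℝ => ∫ t : AddCircle (1 : ℝ), F (ρ * zz t))
      (nhdsWithin 1 (Set.Ioo 0 1)) (nhds (∫ t : AddCircle (1 : ℝ), F (zz t))) := by
    apply tendsto_integral_filter_of_dominated_convergence (fun _ => 1)
    · refine Filter.Eventually.of_forall fun ρ => ?_
      have := continuous_zz.measurable
      exact Measurable.aestronglyMeasurable (by fun_prop)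
    · filter_upwards [self_mem_nhdsWithin] with ρ hρ
      refine Filter.Eventually.of_forall fun t => ?_
      apply quot_norm _ _ hτK
      apply SS_re s hs
      simp [norm_zz, abs_of_pos hρ.1, hρ.2.le]
    · exact integrable_const _
    · have hfin : ({z : ℂ | ∃ a ∈ s, z = a⁻¹}).Finite := by
        have : {z : ℂ | ∃ a ∈ s, z = a⁻¹} = (fun a : ℂ => a⁻¹) '' {a | a ∈ s} := by
          ext z; simp only [Set.mem_ofPred_eq, Set.mem_image, eq_comm]
        rw [this]
        apply Set.Finite.image
        have : {a | a ∈ s} = (s.toFinset : Set ℂ) := by ext; simp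
        rw [this]; exact Finset.finite_toSet _
      filter_upwards [ae_avoid hfin] with t ht
      have hd : DifferentiableAt ℂ (SS s) (zz t) := by
        apply SS_diff
        intro a ha h
        apply ht
        refine ⟨a, ha, ?_⟩
        exact eq_inv_of_mul_eq_one_right (sub_eq_zero.1 h).symm
      have hc : ContinuousAt F (zz t) :=
        (hd.div (hd.add_const _) (add_ne _ _ hτK (SS_re s hs _ (norm_zz t).le))).continuousAt
      have h4 : Filter.Tendsto (fun ρ : ℝ => (ρ : ℂ) * zz t) (nhdsWithin 1 (Set.Ioo 0 1))
          (nhds (zz t)) := by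
        have : Continuous (fun ρ : ℝ => (ρ : ℂ) * zz t) := by fun_prop
        have := this.tendsto 1
        simp only [Complex.ofReal_one, one_mul] at this
        exact this.mono_left nhdsWithin_le_nhds
      exact hc.tendsto.comp h4
  have hne : (nhdsWithin (1 : ℝ) (Set.Ioo 0 1)).NeBot := by
    apply right_nhdsWithin_Ioo_neBot; norm_num
  have hIntegral : ∫ t : AddCircle (1 : ℝ), F (zz t) = ((1 / (1 + τ) : ℝ) : ℂ) := by
    rw [← hF0]
    apply tendsto_nhds_unique hlim
    apply tendsto_const_nhds.congr'
    filter_upwards [self_mem_nhdsWithin] with ρ hρ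
    exact (hmean ρ hρ.1 hρ.2).symm
  have hFi : Integrable (fun t : AddCircle (1 : ℝ) => F (zz t)) := by
    apply Integrable.of_bound (C := 1)
    · have := continuous_zz.measurable
      exact Measurable.aestronglyMeasurable (by fun_prop)
    · refine Filter.Eventually.of_forall fun t => ?_
      exact quot_norm _ _ hτK (SS_re s hs _ (norm_zz t).le)
  have hre : ∫ t : AddCircle (1 : ℝ), (F (zz t)).re = 1 / (1 + τ) := by
    have := integral_re hFi
    simp only [RCLike.re_to_complex] at this
    rw [this, hIntegral, Complex.ofReal_re]
  have hmark := mul_meas_ge_le_integral_of_nonneg (μ := volume)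
    (f := fun t : AddCircle (1 : ℝ) => (F (zz t)).re)
    (Filter.Eventually.of_forall fun t => quot_re _ _ hτK (SS_re s hs _ (norm_zz t).le))
    hFi.re (1 / 2)
  rw [hre] at hmark
  have hsub : volume {t : AddCircle (1 : ℝ) | τ * K ≤ ‖SS s (zz t)‖} ≤
      volume {t : AddCircle (1 : ℝ) | 1 / 2 ≤ (F (zz t)).re} := by
    apply measure_mono
    intro t ht
    exact quot_half _ _ hτK (SS_re s hs _ (norm_zz t).le) ht
  refine hsub.trans ?_
  rw [← ENNReal.ofReal_toReal (measure_ne_top volume _)]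
  apply ENNReal.ofReal_le_ofReal
  have h5 : 2 / (1 + τ) = 2 * (1 / (1 + τ)) := by ring
  rw [h5]
  have h6 : volume.real {t : AddCircle (1 : ℝ) | 1 / 2 ≤ (F (zz t)).re} =
    (volume {t : AddCircle (1 : ℝ) | 1 / 2 ≤ (F (zz t)).re}).toReal := rfl
  rw [← h6]
  linarith

open Classical in
def outS (s : Multiset ℂ) : Multiset ℂ := (s.filter (fun a => 1 ≤ ‖a‖)).map (fun a => a⁻¹)

open Classical in
def innS (s : Multiset ℂ) : Multiset ℂ :=
  (s.filter (fun a => ¬ 1 ≤ ‖a‖)).map (fun a => (starRingEnd ℂ) a)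

lemma outS_le (s : Multiset ℂ) : ∀ a ∈ outS s, ‖a‖ ≤ 1 := by
  intro a ha
  simp only [outS, Multiset.mem_map, Multiset.mem_filter] at ha
  obtain ⟨b, ⟨_, hb⟩, rfl⟩ := ha
  rw [norm_inv]
  exact inv_le_one_of_one_le₀ hb

lemma innS_le (s : Multiset ℂ) : ∀ a ∈ innS s, ‖a‖ ≤ 1 := by
  intro a ha
  simp only [innS, Multiset.mem_map, Multiset.mem_filter] at ha
  obtain ⟨b, ⟨_, hb⟩, rfl⟩ := ha
  rw [RCLike.norm_conj]
  exact (not_le.1 hb).le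

lemma card_out_inn (s : Multiset ℂ) :
    Multiset.card (outS s) + Multiset.card (innS s) = Multiset.card s := by
  simp only [outS, innS, Multiset.card_map]
  rw [← Multiset.card_add, Multiset.filter_add_not]

lemma kernel_out (a z : ℂ) (ha : a ≠ 0) (hz : z ≠ a) :
    z * (1 / (z - a)) = 1 / 2 - (1 + a⁻¹ * z) / (1 - a⁻¹ * z) / 2 := by
  have h1 : z - a ≠ 0 := sub_ne_zero.2 hz
  have h2 : 1 - a⁻¹ * z ≠ 0 := by
    have : 1 - a⁻¹ * z = -(z - a) / a := by field_simp; ring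
    rw [this]; exact div_ne_zero (neg_ne_zero.2 h1) ha
  have h3 : a - z ≠ 0 := sub_ne_zero.2 hz.symm
  field_simp
  ring

lemma kernel_inn (a z : ℂ) (hn : ‖z‖ = 1) (hz : z ≠ a) :
    z * (1 / (z - a)) = 1 / 2 +
      (starRingEnd ℂ) ((1 + (starRingEnd ℂ) a * z) / (1 - (starRingEnd ℂ) a * z)) / 2 := by
  have h1 : z - a ≠ 0 := sub_ne_zero.2 hz
  have hz0 : z ≠ 0 := by intro h; rw [h] at hn; simp at hn
  have hc : (starRingEnd ℂ) z = z⁻¹ := by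
    rw [Complex.inv_def, Complex.normSq_eq_norm_sq, hn]; simp
  simp only [map_div₀, map_add, map_sub, map_mul, map_one, Complex.conj_conj, hc]
  have h2 : 1 - a * z⁻¹ ≠ 0 := by
    have : 1 - a * z⁻¹ = (z - a) / z := by field_simp
    rw [this]; exact div_ne_zero h1 hz0
  field_simp
  ring

lemma log_deriv_sum (s : Multiset ℂ) (z : ℂ) (hn : ‖z‖ = 1) (hs : ∀ a ∈ s, z ≠ a) :
    z * (s.map (fun a => 1 / (z - a))).sum =
      Multiset.card s / 2 - SS (outS s) z / 2 + (starRingEnd ℂ) (SS (innS s) z) / 2 := by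
  induction s using Multiset.induction with
  | empty => simp [SS, outS, innS]
  | cons a s ih =>
    have h1 := ih (fun b hb => hs b (Multiset.mem_cons_of_mem hb))
    have h2 := hs a (Multiset.mem_cons_self a s)
    rw [Multiset.map_cons, Multiset.sum_cons, mul_add, h1, Multiset.card_cons]
    by_cases h : 1 ≤ ‖a‖
    · have ha : a ≠ 0 := by rintro rfl; simp at h; linarith
      have e1 : outS (a ::ₘ s) = a⁻¹ ::ₘ outS s := by simp [outS, h]
      have e2 : innS (a ::ₘ s) = innS s := by simp [innS, h]
      rw [e1, e2, kernel_out a z ha h2]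
      simp only [SS, Multiset.map_cons, Multiset.sum_cons]
      push_cast; ring
    · have e1 : outS (a ::ₘ s) = outS s := by simp [outS, h]
      have e2 : innS (a ::ₘ s) = (starRingEnd ℂ) a ::ₘ innS s := by
        simp [innS, not_le.1 h]
      rw [e1, e2, kernel_inn a z hn h2]
      simp only [SS, Multiset.map_cons, Multiset.sum_cons, map_add]
      push_cast; ring

lemma SS_weak' (s : Multiset ℂ) (hs : ∀ a ∈ s, ‖a‖ ≤ 1) (τ : ℝ) (hτ : 0 < τ) :
    volume {t : AddCircle (1 : ℝ) | τ < ‖SS s (zz t)‖ / Multiset.card s} ≤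
      ENNReal.ofReal (2 / (1 + τ)) := by
  rcases Nat.eq_zero_or_pos (Multiset.card s) with h | h
  · have : {t : AddCircle (1 : ℝ) | τ < ‖SS s (zz t)‖ / Multiset.card s} = ∅ := by
      ext t; simp [h, hτ.le]
    rw [this]; simp
  · refine le_trans (measure_mono ?_) (weak_type_SS s hs h τ hτ)
    intro t ht
    have h' : (0 : ℝ) < Multiset.card s := by exact_mod_cast h
    simp only [Set.mem_ofPred_eq] at ht ⊢
    rw [lt_div_iff₀ h'] at ht
    exact ht.le

lemma SS_norm_le (s : Multiset ℂ) (z : ℂ) (M : ℝ) (hM : ‖SS s z‖ / Multiset.card s ≤ M) :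
    ‖SS s z‖ ≤ Multiset.card s * M := by
  rcases Nat.eq_zero_or_pos (Multiset.card s) with h | h
  · rw [Multiset.card_eq_zero.1 h]; simp [SS]
  · have h' : (0 : ℝ) < Multiset.card s := by exact_mod_cast h
    rw [div_le_iff₀ h'] at hM; linarith

open Polynomial in
/-- Weak type bound for the logarithmic derivative of a polynomial on the circle. -/
lemma log_deriv_weak (P : ℂ[X]) (N : ℕ) (hN : P.natDegree ≤ N) :
    ∃ M : AddCircle (1 : ℝ) → ℝ,
      (∀ s : ℝ, 0 < s → volume {t | s < M t} ≤ ENNReal.ofReal (2 / s)) ∧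
      (∀ t, 0 ≤ M t) ∧
      ∀ t, P.eval (zz t) ≠ 0 →
        ‖zz t * P.derivative.eval (zz t)‖ ≤ N * M t * ‖P.eval (zz t)‖ ∧
        ‖N * P.eval (zz t) - zz t * P.derivative.eval (zz t)‖ ≤ N * M t * ‖P.eval (zz t)‖ := by
  set A := outS P.roots with hA
  set B := innS P.roots with hB
  set M : AddCircle (1 : ℝ) → ℝ := fun t =>
    max 1 (max (‖SS A (zz t)‖ / Multiset.card A) (‖SS B (zz t)‖ / Multiset.card B)) with hM
  refine ⟨fun t => (1 + M t) / 2, ?_, ?_, ?_⟩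
  · intro s hs
    rcases le_or_gt s 1 with h1 | h1
    · calc volume {t | s < (1 + M t) / 2} ≤ volume Set.univ := measure_mono (Set.subset_univ _)
        _ = 1 := by simp
        _ ≤ ENNReal.ofReal (2 / s) := by
          rw [← ENNReal.ofReal_one]
          apply ENNReal.ofReal_le_ofReal
          rw [le_div_iff₀ hs]; linarith
    · have hsub : {t | s < (1 + M t) / 2} ⊆
          {t | 2 * s - 1 < ‖SS A (zz t)‖ / Multiset.card A} ∪
          {t | 2 * s - 1 < ‖SS B (zz t)‖ / Multiset.card B} := by
        intro t ht
        simp only [Set.mem_ofPred_eq] at ht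
        have h2 : 2 * s - 1 < M t := by linarith
        rcases lt_max_iff.1 h2 with h3 | h3
        · linarith
        · exact lt_max_iff.1 h3
      have e : 2 / s = 2 / (1 + (2 * s - 1)) + 2 / (1 + (2 * s - 1)) := by
        have : 1 + (2 * s - 1) = 2 * s := by ring
        rw [this]; field_simp; norm_num
      rw [e, ENNReal.ofReal_add (by apply div_nonneg <;> linarith)
        (by apply div_nonneg <;> linarith)]
      refine (measure_mono hsub).trans ((measure_union_le _ _).trans ?_)
      exact add_le_add (SS_weak' A (outS_le _) _ (by linarith))
        (SS_weak' B (innS_le _) _ (by linarith))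
  · intro t
    have : 1 ≤ M t := le_max_left _ _
    linarith
  · intro t ht
    have hM1 : 1 ≤ M t := le_max_left _ _
    have hMA : ‖SS A (zz t)‖ ≤ Multiset.card A * M t :=
      SS_norm_le _ _ _ ((le_max_left _ _).trans (le_max_right _ _))
    have hMB : ‖SS B (zz t)‖ ≤ Multiset.card B * M t :=
      SS_norm_le _ _ _ ((le_max_right _ _).trans (le_max_right _ _))
    have hsp : P.Splits := IsAlgClosed.splits P
    have hP0 : P ≠ 0 := by rintro rfl; simp at ht
    have hd := hsp.eval_derivative_eq_eval_mul_sum ht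
    have hl := log_deriv_sum P.roots (zz t) (norm_zz t) (by
      intro a ha h
      rw [Polynomial.mem_roots hP0] at ha
      rw [h] at ht
      exact ht ha)
    have hcard : (Multiset.card A : ℝ) + Multiset.card B = Multiset.card P.roots := by
      exact_mod_cast card_out_inn P.roots
    have hDN : (Multiset.card P.roots : ℝ) ≤ N := by
      exact_mod_cast (Polynomial.card_roots' P).trans hN
    set D : ℕ := Multiset.card P.roots with hD
    set L := zz t * (P.roots.map (fun a => 1 / (zz t - a))).sum with hL
    have hq : zz t * P.derivative.eval (zz t) = L * P.eval (zz t) := by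
      rw [hd, hL]; ring
    have hG : ‖- SS A (zz t) / 2 + (starRingEnd ℂ) (SS B (zz t)) / 2‖ ≤ D * M t / 2 := by
      refine (norm_add_le _ _).trans ?_
      rw [norm_div, norm_div, norm_neg, RCLike.norm_conj, ← hcard]
      simp only [Complex.norm_ofNat]
      linarith
    have hb1 : ‖L‖ ≤ N * ((1 + M t) / 2) := by
      have : L = (D / 2 : ℝ) + (- SS A (zz t) / 2 + (starRingEnd ℂ) (SS B (zz t)) / 2) := by
        rw [hl]; push_cast; ring
      rw [this]
      refine (norm_add_le _ _).trans ?_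
      rw [Complex.norm_real, Real.norm_of_nonneg (by positivity)]
      nlinarith
    have hb2 : ‖(N : ℂ) - L‖ ≤ N * ((1 + M t) / 2) := by
      have : (N : ℂ) - L = (N - D / 2 : ℝ) -
          (- SS A (zz t) / 2 + (starRingEnd ℂ) (SS B (zz t)) / 2) := by
        rw [hl]; push_cast; ring
      rw [this]
      refine (norm_sub_le _ _).trans ?_
      rw [Complex.norm_real, Real.norm_of_nonneg (by
        have : (0 : ℝ) ≤ D := by positivity
        linarith)]
      nlinarith
    constructor
    · rw [hq, norm_mul]
      exact mul_le_mul_of_nonneg_right hb1 (norm_nonneg _)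
    · rw [hq, ← sub_mul, norm_mul]
      exact mul_le_mul_of_nonneg_right hb2 (norm_nonneg _)

/-- exponential sum -/
def pp (S : Finset ℤ) (c : ℤ → ℂ) (t : AddCircle (1 : ℝ)) : ℂ := ∑ k ∈ S, c k * zz t ^ k

lemma continuous_pp (S : Finset ℤ) (c : ℤ → ℂ) : Continuous (pp S c) := by
  unfold pp
  refine continuous_finsetSum _ fun k _ => continuous_const.mul ?_
  exact continuous_zz.zpow₀ k (fun t => Or.inl (zz_ne t))

open Polynomial in
lemma pp_weak (S : Finset ℤ) (c : ℤ → ℂ) (a b : ℤ) (hab : a < b) (ha : ∀ k ∈ S, a ≤ k)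
    (hb : ∀ k ∈ S, k ≤ b) (hc : ∃ k ∈ S, c k ≠ 0) :
    (∀ᵐ t, pp S c t ≠ 0) ∧
    ∃ M : AddCircle (1 : ℝ) → ℝ,
      (∀ s : ℝ, 0 < s → volume {t | s < M t} ≤ ENNReal.ofReal (2 / s)) ∧
      (∀ t, 0 ≤ M t) ∧
      ∀ t, pp S c t ≠ 0 →
        ‖pp S (fun k => (k - a : ℤ) * c k) t‖ ≤ (b - a : ℤ) * M t * ‖pp S c t‖ ∧
        ‖pp S (fun k => (b - k : ℤ) * c k) t‖ ≤ (b - a : ℤ) * M t * ‖pp S c t‖ := by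
  set P : ℂ[X] := ∑ k ∈ S, C (c k) * X ^ (k - a).toNat with hP
  obtain ⟨N, hN⟩ : ∃ N : ℕ, (b - a : ℤ) = N := ⟨(b - a).toNat, by omega⟩
  have hdeg : P.natDegree ≤ N := by
    apply Polynomial.natDegree_sum_le_of_forall_le
    intro k hk
    refine (Polynomial.natDegree_C_mul_X_pow_le _ _).trans ?_
    have := ha k hk; have := hb k hk; omega
  have hP0 : P ≠ 0 := by
    obtain ⟨k, hk, hck⟩ := hc
    intro h
    apply hck
    have h1 : P.coeff (k - a).toNat = c k := by
      rw [hP, Polynomial.finsetSum_coeff]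
      rw [Finset.sum_eq_single k]
      · simp
      · intro j hj hjk
        rw [Polynomial.coeff_C_mul_X_pow, if_neg]
        have := ha k hk; have := ha j hj; omega
      · intro h; exact absurd hk h
    rw [← h1, h]; simp
  have hpow : ∀ t : AddCircle (1 : ℝ), ∀ k ∈ S, zz t ^ (k - a).toNat = zz t ^ k / zz t ^ a := by
    intro t k hk
    rw [← zpow_natCast, Int.toNat_of_nonneg (by have := ha k hk; omega), zpow_sub₀ (zz_ne t)]
  have hev : ∀ t, P.eval (zz t) = pp S c t / zz t ^ a := by
    intro t
    rw [hP, Polynomial.eval_finsetSum, pp, Finset.sum_div]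
    refine Finset.sum_congr rfl fun k hk => ?_
    rw [Polynomial.eval_mul, Polynomial.eval_C, Polynomial.eval_pow, Polynomial.eval_X,
      hpow t k hk, mul_div_assoc]
  have hder : ∀ t, zz t * P.derivative.eval (zz t) =
      pp S (fun k => (k - a : ℤ) * c k) t / zz t ^ a := by
    intro t
    rw [hP, Polynomial.derivative_sum, Polynomial.eval_finsetSum, pp, Finset.sum_div,
      Finset.mul_sum]
    refine Finset.sum_congr rfl fun k hk => ?_
    rw [Polynomial.derivative_C_mul_X_pow]
    simp only [Polynomial.eval_mul, Polynomial.eval_C, Polynomial.eval_pow, Polynomial.eval_X]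
    rw [mul_div_assoc, ← hpow t k hk]
    have h2 : (((k - a).toNat : ℕ) : ℂ) = ((k - a : ℤ) : ℂ) := by
      have : (((k - a).toNat : ℕ) : ℤ) = k - a := Int.toNat_of_nonneg (by have := ha k hk; omega)
      exact_mod_cast congrArg (Int.cast (R := ℂ)) this
    rw [h2]
    rcases Nat.eq_zero_or_pos (k - a).toNat with h | h
    · have : k - a = 0 := by have := ha k hk; omega
      rw [this]; simp
    · obtain ⟨j, hj⟩ := Nat.exists_eq_succ_of_ne_zero h.ne'
      rw [hj]; simp only [Nat.succ_eq_add_one, Nat.add_sub_cancel, pow_succ]; ring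
  have hder2 : ∀ t, N * P.eval (zz t) - zz t * P.derivative.eval (zz t) =
      pp S (fun k => (b - k : ℤ) * c k) t / zz t ^ a := by
    intro t
    rw [hev, hder, ← mul_div_assoc, ← sub_div]
    congr 1
    simp only [pp]
    rw [Finset.mul_sum, ← Finset.sum_sub_distrib]
    refine Finset.sum_congr rfl fun k hk => ?_
    have : (N : ℂ) = ((b - a : ℤ) : ℂ) := by rw [hN]; simp
    rw [this]; push_cast; ring
  have hnz : ∀ t, ‖zz t ^ a‖ = 1 := by intro t; rw [norm_zpow, norm_zz, one_zpow]
  refine ⟨?_, ?_⟩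
  · have hfin : {z : ℂ | P.IsRoot z}.Finite := Polynomial.finite_setOfPred_isRoot hP0
    filter_upwards [ae_avoid hfin] with t ht h
    apply ht
    simp [Polynomial.IsRoot, hev, h]
  · obtain ⟨M, hM1, hM0, hM2⟩ := log_deriv_weak P N hdeg
    refine ⟨M, hM1, hM0, fun t ht => ?_⟩
    have h := hM2 t (by
      rw [hev]
      exact div_ne_zero ht (zpow_ne_zero _ (zz_ne t)))
    rw [hder2, hder, hev, norm_div, norm_div, norm_div, hnz, div_one, div_one, div_one] at h
    have e : ((b - a : ℤ) : ℝ) = N := by rw [hN]; simp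
    rw [e]; exact h

lemma chain (n : ℕ) : ∀ (S : Finset ℤ) (c : ℤ → ℂ), S.card = n + 1 →
    ∃ X : Fin n → AddCircle (1 : ℝ) → ℝ, (∀ j, Measurable (X j)) ∧ (∀ j t, 0 ≤ X j t) ∧
      (∀ j, ∀ s : ℝ, 0 < s → volume {t | s < X j t} ≤ ENNReal.ofReal (2 / s)) ∧
      ∀ᵐ t, ∑ k ∈ S, ‖c k‖ ≤ 2 ^ n * ‖pp S c t‖ * ∏ j, X j t := by
  induction n with
  | zero =>
    intro S c hS
    obtain ⟨a, rfl⟩ := Finset.card_eq_one.1 (by simpa using hS)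
    refine ⟨fun j => j.elim0, fun j => j.elim0, fun j => j.elim0, fun j => j.elim0, ?_⟩
    refine Filter.Eventually.of_forall fun t => ?_
    simp [pp, norm_zz]
  | succ n ih =>
    intro S c hS
    by_cases hc : ∃ k ∈ S, c k ≠ 0
    swap
    · push Not at hc
      refine ⟨fun j _ => 0, fun j => measurable_const, fun j t => le_rfl, ?_, ?_⟩
      · intro j s hs
        have : {t : AddCircle (1 : ℝ) | s < 0} = ∅ := by ext t; simp [hs.le]
        rw [this]; simp
      · refine Filter.Eventually.of_forall fun t => ?_
        rw [Finset.sum_eq_zero (fun k hk => by simp [hc k hk])]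
        positivity
    have hne : S.Nonempty := Finset.card_pos.1 (by omega)
    set a := S.min' hne with ha
    set b := S.max' hne with hb
    have hab : a < b := Finset.min'_lt_max'_of_card S (by omega)
    have haS : a ∈ S := S.min'_mem hne
    have hbS : b ∈ S := S.max'_mem hne
    have hle : ∀ k ∈ S, a ≤ k := fun k hk => S.min'_le k hk
    have hge : ∀ k ∈ S, k ≤ b := fun k hk => S.le_max' k hk
    obtain ⟨hae, M, hM1, hM0, hM2⟩ := pp_weak S c a b hab hle hge hc
    have hN0 : (0 : ℝ) < (b - a : ℤ) := by exact_mod_cast sub_pos.2 hab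
    -- choice of side
    obtain ⟨e, c', heS, hW, hq⟩ : ∃ (e : ℤ) (c' : ℤ → ℂ), e ∈ S ∧
        (b - a : ℤ) * ∑ k ∈ S, ‖c k‖ ≤ 2 * ∑ k ∈ S.erase e, ‖c' k‖ ∧
        ∀ t, pp S c t ≠ 0 → ‖pp (S.erase e) c' t‖ ≤ (b - a : ℤ) * M t * ‖pp S c t‖ := by
      have hsum : (b - a : ℤ) * ∑ k ∈ S, ‖c k‖ =
          ∑ k ∈ S, ‖((k - a : ℤ) : ℂ) * c k‖ + ∑ k ∈ S, ‖((b - k : ℤ) : ℂ) * c k‖ := by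
        rw [← Finset.sum_add_distrib, Finset.mul_sum]
        refine Finset.sum_congr rfl fun k hk => ?_
        rw [norm_mul, norm_mul, Complex.norm_intCast, Complex.norm_intCast,
          abs_of_nonneg (by exact_mod_cast sub_nonneg.2 (hle k hk)),
          abs_of_nonneg (by exact_mod_cast sub_nonneg.2 (hge k hk))]
        push_cast; ring
      rcases le_total (∑ k ∈ S, ‖((k - a : ℤ) : ℂ) * c k‖)
        (∑ k ∈ S, ‖((b - k : ℤ) : ℂ) * c k‖) with h | h
      · refine ⟨b, fun k => (b - k : ℤ) * c k, hbS, ?_, ?_⟩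
        · rw [Finset.sum_erase _ (by simp)]; linarith
        · intro t ht
          have := (hM2 t ht).2
          rw [pp, Finset.sum_erase _ (by simp)]; exact this
      · refine ⟨a, fun k => (k - a : ℤ) * c k, haS, ?_, ?_⟩
        · rw [Finset.sum_erase _ (by simp)]; linarith
        · intro t ht
          have := (hM2 t ht).1
          rw [pp, Finset.sum_erase _ (by simp)]; exact this
    obtain ⟨X, hXm, hX0, hXw, hX⟩ := ih (S.erase e) c' (by rw [Finset.card_erase_of_mem heS, hS]; simp)
    set Y : AddCircle (1 : ℝ) → ℝ := fun t =>
      ‖pp (S.erase e) c' t‖ / ((b - a : ℤ) * ‖pp S c t‖) with hY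
    have hYM : ∀ t, Y t ≤ M t := by
      intro t
      by_cases ht : pp S c t = 0
      · simp [hY, ht, hM0 t]
      · have : 0 < (b - a : ℤ) * ‖pp S c t‖ := mul_pos hN0 (norm_pos_iff.2 ht)
        rw [hY]; simp only
        rw [div_le_iff₀ this]
        have := hq t ht
        linarith
    refine ⟨Fin.cons Y X, ?_, ?_, ?_, ?_⟩
    · intro j
      refine Fin.cases ?_ (fun j => ?_) j
      · have h1 := (continuous_pp S c).measurable
        have h2 := (continuous_pp (S.erase e) c').measurable
        simp only [Fin.cons_zero, hY]
        fun_prop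
      · simpa using hXm j
    · intro j t
      refine Fin.cases ?_ (fun j => ?_) j
      · simp only [Fin.cons_zero, hY]; positivity
      · simpa using hX0 j t
    · intro j s hs
      refine Fin.cases ?_ (fun j => ?_) j
      · refine (measure_mono ?_).trans (hM1 s hs)
        intro t ht
        simp only [Fin.cons_zero, Set.mem_ofPred_eq] at ht ⊢
        exact lt_of_lt_of_le ht (hYM t)
      · simpa using hXw j s hs
    · filter_upwards [hX, hae] with t h1 h2
      rw [Fin.prod_univ_succ]
      simp only [Fin.cons_zero, Fin.cons_succ]
      have h3 : ‖pp (S.erase e) c' t‖ = (b - a : ℤ) * (‖pp S c t‖ * Y t) := by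
        have : ‖pp S c t‖ ≠ 0 := norm_ne_zero_iff.2 h2
        simp only [hY]; field_simp
      rw [h3] at h1
      have h4 : (b - a : ℤ) * ∑ k ∈ S, ‖c k‖ ≤ (b - a : ℤ) *
          (2 ^ (n + 1) * ‖pp S c t‖ * (Y t * ∏ j, X j t)) := by
        refine hW.trans ((mul_le_mul_of_nonneg_left h1 (by norm_num)).trans (le_of_eq ?_))
        ring
      exact le_of_mul_le_mul_left h4 hN0

lemma third_int (X : AddCircle (1 : ℝ) → ℝ) (hXm : Measurable X) (hX0 : ∀ t, 0 ≤ X t)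
    (hw : ∀ s : ℝ, 0 < s → volume {t | s < X t} ≤ ENNReal.ofReal (2 / s))
    (E : Set (AddCircle (1 : ℝ))) (e u : ℝ) (he : 0 < e)
    (hE : volume E = ENNReal.ofReal e) (hu : 0 < u) (hue : u ^ 3 = 2 / e) :
    ∫⁻ t in E, ENNReal.ofReal (X t ^ (1 / 3 : ℝ)) ≤ ENNReal.ofReal (3 / 2 * e * u) := by
  rw [lintegral_eq_lintegral_meas_lt (volume.restrict E)
    (Filter.Eventually.of_forall fun t => Real.rpow_nonneg (hX0 t) _)
    (hXm.pow_const _).aemeasurable]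
  rw [← Set.Ioc_union_Ioi_eq_Ioi hu.le]
  refine (lintegral_union_le _ _ _).trans ?_
  have h1 : ∫⁻ s in Set.Ioc 0 u, (volume.restrict E) {t | s < X t ^ (1 / 3 : ℝ)} ≤
      ENNReal.ofReal (e * u) := by
    calc _ ≤ ∫⁻ s in Set.Ioc 0 u, ENNReal.ofReal e := by
          apply lintegral_mono
          intro s
          rw [← hE, ← Measure.restrict_apply_univ E]
          exact measure_mono (Set.subset_univ _)
      _ = ENNReal.ofReal (e * u) := by
          rw [setLIntegral_const, Real.volume_Ioc, sub_zero, ENNReal.ofReal_mul he.le]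
  have h2 : ∫⁻ s in Set.Ioi u, (volume.restrict E) {t | s < X t ^ (1 / 3 : ℝ)} ≤
      ENNReal.ofReal (1 / 2 * e * u) := by
    calc _ ≤ ∫⁻ s in Set.Ioi u, ENNReal.ofReal (2 * s ^ (-3 : ℝ)) := by
          apply setLIntegral_mono' measurableSet_Ioi
          intro s hs
          have hs0 : 0 < s := hu.trans hs
          have e1 : 2 * s ^ (-3 : ℝ) = 2 / s ^ 3 := by
            rw [Real.rpow_neg hs0.le]; norm_cast
          rw [e1]
          refine (Measure.restrict_apply_le _ _).trans (le_trans (measure_mono ?_) (hw (s ^ 3) (by positivity)))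
          intro t ht
          simp only [Set.mem_ofPred_eq] at ht ⊢
          have e2 : (X t ^ (1 / 3 : ℝ)) ^ 3 = X t := by
            rw [← Real.rpow_natCast, ← Real.rpow_mul (hX0 t)]; norm_num
          rw [← e2]
          exact pow_lt_pow_left₀ ht hs0.le (by norm_num)
      _ = ENNReal.ofReal (∫ s in Set.Ioi u, 2 * s ^ (-3 : ℝ)) := by
          rw [ofReal_integral_eq_lintegral_ofReal]
          · exact (integrableOn_Ioi_rpow_of_lt (by norm_num) hu).const_mul _
          · filter_upwards [ae_restrict_mem measurableSet_Ioi] with s hs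
            have hs0 : 0 < s := hu.trans hs
            simp only [Pi.zero_apply]
            positivity
      _ = ENNReal.ofReal (1 / 2 * e * u) := by
          congr 1
          rw [integral_const_mul, integral_Ioi_rpow_of_lt (by norm_num) hu]
          have e3 : u ^ ((-3 : ℝ) + 1) = (u ^ 2)⁻¹ := by
            rw [show (-3 : ℝ) + 1 = -(2 : ℕ) by norm_num, Real.rpow_neg hu.le, Real.rpow_natCast]
          rw [e3]
          have e4 : e * u ^ 3 = 2 := by rw [hue]; field_simp
          field_simp
          nlinarith
  refine (add_le_add h1 h2).trans ?_
  rw [← ENNReal.ofReal_add (by positivity) (by positivity)]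
  apply ENNReal.ofReal_le_ofReal
  linarith

lemma amgm (n : ℕ) (y : Fin n → ℝ) (hy : ∀ j, 0 ≤ y j) (v : ℝ)
    (h : ∑ j, y j ≤ n * v) : ∏ j, y j ≤ v ^ n := by
  rcases Nat.eq_zero_or_pos n with h0 | h0
  · subst h0; simp
  have hn : (0 : ℝ) < n := by exact_mod_cast h0
  have := Real.geom_mean_le_arith_mean Finset.univ (fun _ => (1 : ℝ)) y (by simp) (by simpa using h0)
    (fun j _ => hy j)
  simp only [Real.rpow_one, Finset.sum_const, Finset.card_univ, Fintype.card_fin, nsmul_eq_mul,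
    mul_one, one_mul] at this
  have hP : 0 ≤ ∏ j, y j := Finset.prod_nonneg fun j _ => hy j
  have h2 : (∏ j, y j) ^ ((n : ℝ)⁻¹) ≤ v := this.trans (by rw [div_le_iff₀ hn]; linarith)
  have h3 := pow_le_pow_left₀ (Real.rpow_nonneg hP _) h2 n
  rwa [Real.rpow_inv_natCast_pow hP h0.ne'] at h3

lemma turan_S (n : ℕ) (S : Finset ℤ) (c : ℤ → ℂ) (hS : S.card = n + 1)
    (E : Set (AddCircle (1 : ℝ))) (hEm : MeasurableSet E) (hE0 : 0 < volume E) (B : ℝ)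
    (hB : ∀ t ∈ E, ‖pp S c t‖ ≤ B) :
    ∑ k ∈ S, ‖c k‖ ≤ (14 / (volume E).toReal) ^ n * B := by
  set e := (volume E).toReal with he
  have he0 : 0 < e := ENNReal.toReal_pos hE0.ne' (measure_ne_top _ _)
  have hEe : volume E = ENNReal.ofReal e := (ENNReal.ofReal_toReal (measure_ne_top _ _)).symm
  obtain ⟨X, hXm, hX0, hXw, hX⟩ := chain n S c hS
  set u : ℝ := (2 / e) ^ (1 / 3 : ℝ) with hu
  have hu0 : 0 < u := by positivity
  have hu3 : u ^ 3 = 2 / e := by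
    rw [hu, ← Real.rpow_natCast, ← Real.rpow_mul (by positivity)]; norm_num
  set f : AddCircle (1 : ℝ) → ℝ≥0∞ := fun t => ∑ j, ENNReal.ofReal (X j t ^ (1 / 3 : ℝ)) with hf
  have hfm : ∀ j, Measurable fun t => ENNReal.ofReal (X j t ^ (1 / 3 : ℝ)) := fun j =>
    ((hXm j).pow_const _).ennreal_ofReal
  have hIntegral : ∫⁻ t in E, f t ≤ ENNReal.ofReal (n * (3 / 2 * e * u)) := by
    rw [hf, lintegral_finsetSum _ (fun j _ => hfm j)]
    calc _ ≤ ∑ j : Fin n, ENNReal.ofReal (3 / 2 * e * u) :=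
          Finset.sum_le_sum fun j _ => third_int (X j) (hXm j) (hX0 j) (hXw j) E e u he0 hEe hu0 hu3
      _ = _ := by
          rw [Finset.sum_const, Finset.card_univ, Fintype.card_fin, nsmul_eq_mul,
            ENNReal.ofReal_mul (p := (n : ℝ)) (by positivity), ENNReal.ofReal_natCast]
  obtain ⟨t, htN, htf⟩ := exists_notMem_null_le_laverage (μ := volume.restrict E) (f := f)
    (N := {t | ¬ (∑ k ∈ S, ‖c k‖ ≤ 2 ^ n * ‖pp S c t‖ * ∏ j, X j t)} ∪ Eᶜ)
    (by
      intro h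
      rw [Measure.restrict_eq_zero] at h
      exact hE0.ne' h)
    (Finset.measurable_sum _ fun j _ => hfm j).aemeasurable
    (by
      apply measure_union_null
      · exact (Measure.absolutelyContinuous_of_le Measure.restrict_le_self) hX
      · rw [Measure.restrict_apply hEm.compl]; simp)
  simp only [Set.mem_union, not_or, Set.mem_ofPred_eq, not_not, Set.mem_compl_iff] at htN
  obtain ⟨ht1, htE⟩ := htN
  have hsum : ∑ j, X j t ^ (1 / 3 : ℝ) ≤ n * (3 / 2 * u) := by
    have h1 : f t ≤ ENNReal.ofReal (n * (3 / 2 * u)) := by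
      refine htf.trans ?_
      rw [laverage_eq, Measure.restrict_apply_univ, hEe]
      refine (ENNReal.div_le_div_right hIntegral _).trans ?_
      rw [← ENNReal.ofReal_div_of_pos he0]
      apply ENNReal.ofReal_le_ofReal
      apply le_of_eq
      field_simp
    rw [hf] at h1
    simp only at h1
    rw [← ENNReal.ofReal_sum_of_nonneg (fun j _ => Real.rpow_nonneg (hX0 j t) _)] at h1
    exact (ENNReal.ofReal_le_ofReal_iff (by positivity)).1 h1
  have hprod := amgm n (fun j => X j t ^ (1 / 3 : ℝ)) (fun j => Real.rpow_nonneg (hX0 j t) _) _ hsum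
  have hX3 : ∏ j, X j t ≤ (27 / 4 / e) ^ n := by
    have e1 : ∏ j, X j t = (∏ j, X j t ^ (1 / 3 : ℝ)) ^ 3 := by
      rw [← Finset.prod_pow]
      refine Finset.prod_congr rfl fun j _ => ?_
      rw [← Real.rpow_natCast, ← Real.rpow_mul (hX0 j t)]; norm_num
    have e2 : (27 / 4 / e) ^ n = ((3 / 2 * u) ^ n) ^ 3 := by
      rw [← pow_mul, mul_comm n 3, pow_mul, mul_pow, hu3]
      congr 1
      field_simp; norm_num
    rw [e1, e2]
    exact pow_le_pow_left₀ (Finset.prod_nonneg fun j _ => Real.rpow_nonneg (hX0 j t) _) hprod 3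
  have hB0 : 0 ≤ B := (norm_nonneg _).trans (hB t htE)
  calc ∑ k ∈ S, ‖c k‖ ≤ 2 ^ n * ‖pp S c t‖ * ∏ j, X j t := ht1
    _ ≤ 2 ^ n * B * (27 / 4 / e) ^ n := by
        apply mul_le_mul _ hX3 (Finset.prod_nonneg fun j _ => hX0 j t) (by positivity)
        exact mul_le_mul_of_nonneg_left (hB t htE) (by positivity)
    _ = (27 / 2 / e) ^ n * B := by
        rw [mul_right_comm, ← mul_pow]; congr 2; ring
    _ ≤ (14 / e) ^ n * B := by
        gcongr; norm_num

lemma turan_one (m : ℕ) (c : Fin (m + 1) → ℂ) (r : Fin (m + 1) → ℤ)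
    (E : Set (AddCircle (1 : ℝ))) (hEm : MeasurableSet E) (hE0 : 0 < volume E) (B : ℝ)
    (hB : ∀ t ∈ E, ‖∑ k, c k * fourier (r k) t‖ ≤ B) (t : AddCircle (1 : ℝ)) :
    ‖∑ k, c k * fourier (r k) t‖ ≤ (14 / (volume E).toReal) ^ m * B := by
  classical
  set S : Finset ℤ := Finset.univ.image r with hS
  set c' : ℤ → ℂ := fun n => ∑ k with r k = n, c k with hc'
  have hp : ∀ t, ∑ k, c k * fourier (r k) t = pp S c' t := by
    intro t
    rw [pp, ← Finset.sum_fiberwise_of_maps_to (s := Finset.univ) (t := S) (g := r)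
      (fun k _ => Finset.mem_image_of_mem r (Finset.mem_univ k))]
    refine Finset.sum_congr rfl fun n _ => ?_
    rw [hc', Finset.sum_mul]
    refine Finset.sum_congr rfl fun k hk => ?_
    rw [fourier_zz, (Finset.mem_filter.1 hk).2]
  have hcard : S.card ≤ m + 1 := by
    have := Finset.card_image_le (s := (Finset.univ : Finset (Fin (m + 1)))) (f := r)
    simpa using this
  have hpos : 0 < S.card := by
    apply Finset.card_pos.2
    exact ⟨r 0, Finset.mem_image_of_mem r (Finset.mem_univ 0)⟩
  obtain ⟨n, hn⟩ : ∃ n, S.card = n + 1 := ⟨S.card - 1, by omega⟩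
  simp only [hp] at hB ⊢
  have h := turan_S n S c' hn E hEm hE0 B hB
  have he0 : 0 < (volume E).toReal := ENNReal.toReal_pos hE0.ne' (measure_ne_top _ _)
  have he1 : (volume E).toReal ≤ 1 := by
    have : volume E ≤ 1 := by
      calc volume E ≤ volume Set.univ := measure_mono (Set.subset_univ _)
        _ = 1 := by simp
    exact ENNReal.toReal_le_of_le_ofReal (by norm_num) (by simpa using this)
  obtain ⟨x, hx⟩ := nonempty_of_measure_ne_zero hE0.ne'
  have hB0 : 0 ≤ B := (norm_nonneg _).trans (hB x hx)
  calc ‖pp S c' t‖ ≤ ∑ k ∈ S, ‖c' k‖ := by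
        rw [pp]
        refine (norm_sum_le _ _).trans (le_of_eq ?_)
        refine Finset.sum_congr rfl fun k _ => ?_
        rw [norm_mul, norm_zpow, norm_zz, one_zpow, mul_one]
    _ ≤ (14 / (volume E).toReal) ^ n * B := h
    _ ≤ (14 / (volume E).toReal) ^ m * B := by
        apply mul_le_mul_of_nonneg_right _ hB0
        apply pow_le_pow_right₀
        · rw [le_div_iff₀ he0]; linarith
        · omega

instance : IsProbabilityMeasure (volume : Measure (AddCircle (1 : ℝ))) := ⟨by simp⟩

lemma turan_multi (d : ℕ) : ∀ (m : Fin d → ℕ)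
    (c : (∀ i, Fin (m i + 1)) → ℂ) (r : ∀ i : Fin d, Fin (m i + 1) → ℤ)
    (E : Set (∀ _ : Fin d, AddCircle (1 : ℝ))) (_ : MeasurableSet E)
    (_ : 0 < volume E) (B : ℝ)
    (_ : ∀ t ∈ E, ‖∑ k : ∀ i, Fin (m i + 1), c k * ∏ i, fourier (r i (k i)) (t i)‖ ≤ B)
    (t : ∀ _ : Fin d, AddCircle (1 : ℝ)),
    ‖∑ k : ∀ i, Fin (m i + 1), c k * ∏ i, fourier (r i (k i)) (t i)‖ ≤
      (14 * d / (volume E).toReal) ^ (∑ i, m i) * B := by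
  induction d with
  | zero =>
    intro m c r E hE hE0 B hB t
    obtain ⟨x, hx⟩ := nonempty_of_measure_ne_zero hE0.ne'
    have := hB x hx
    rw [Subsingleton.elim t x]
    simpa using this
  | succ d ih =>
    intro m c r E hE hE0 B hB t
    set p : (∀ _ : Fin (d + 1), AddCircle (1 : ℝ)) → ℂ := fun t =>
      ∑ k : ∀ i, Fin (m i + 1), c k * ∏ i, fourier (r i (k i)) (t i) with hp
    set e := (volume E).toReal with he
    have he0 : 0 < e := ENNReal.toReal_pos hE0.ne' (measure_ne_top _ _)
    have hEe : volume E = ENNReal.ofReal e := (ENNReal.ofReal_toReal (measure_ne_top _ _)).symm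
    obtain ⟨x0, hx0⟩ := nonempty_of_measure_ne_zero hE0.ne'
    have hB0 : 0 ≤ B := (norm_nonneg _).trans (hB x0 hx0)
    have hpc : ∀ (x : AddCircle (1 : ℝ)) (y : Fin d → AddCircle (1 : ℝ)),
        p (Fin.cons x y) = ∑ k0 : Fin (m 0 + 1), ∑ k' : ∀ i : Fin d, Fin (m i.succ + 1),
          c (Fin.cons k0 k') * (fourier (r 0 k0) x * ∏ i, fourier (r i.succ (k' i)) (y i)) := by
      intro x y
      simp only [hp]
      rw [← (Fin.consEquiv (fun i => Fin (m i + 1))).sum_comp, Fintype.sum_prod_type]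
      refine Finset.sum_congr rfl fun k0 _ => Finset.sum_congr rfl fun k' _ => ?_
      rw [Fin.prod_univ_succ]
      simp [Fin.consEquiv]
    have hp1 : ∀ (x : AddCircle (1 : ℝ)) (y : Fin d → AddCircle (1 : ℝ)),
        p (Fin.cons x y) = ∑ k0 : Fin (m 0 + 1), (∑ k' : ∀ i : Fin d, Fin (m i.succ + 1),
          c (Fin.cons k0 k') * ∏ i, fourier (r i.succ (k' i)) (y i)) * fourier (r 0 k0) x := by
      intro x y
      rw [hpc]
      refine Finset.sum_congr rfl fun k0 _ => ?_
      rw [Finset.sum_mul]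
      refine Finset.sum_congr rfl fun k' _ => ?_
      ring
    have hp2 : ∀ (x : AddCircle (1 : ℝ)) (y : Fin d → AddCircle (1 : ℝ)),
        p (Fin.cons x y) = ∑ k' : ∀ i : Fin d, Fin (m i.succ + 1),
          (∑ k0 : Fin (m 0 + 1), c (Fin.cons k0 k') * fourier (r 0 k0) x) *
            ∏ i, fourier (r i.succ (k' i)) (y i) := by
      intro x y
      rw [hpc, Finset.sum_comm]
      refine Finset.sum_congr rfl fun k' _ => ?_
      rw [Finset.sum_mul]
      refine Finset.sum_congr rfl fun k0 _ => ?_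
      ring
    -- transfer to the product
    set E' : Set (AddCircle (1 : ℝ) × (Fin d → AddCircle (1 : ℝ))) :=
      {q | (Fin.cons q.1 q.2 : Fin (d + 1) → AddCircle (1 : ℝ)) ∈ E} with hE'
    have hpres := (volume_preserving_piFinSuccAbove
      (fun _ : Fin (d + 1) => AddCircle (1 : ℝ)) 0).symm
    have hpre : (MeasurableEquiv.piFinSuccAbove
        (fun _ : Fin (d + 1) => AddCircle (1 : ℝ)) 0).symm ⁻¹' E = E' := by
      ext q
      simp [hE', MeasurableEquiv.piFinSuccAbove, Fin.insertNthEquiv]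
    have hE'm : MeasurableSet E' := by
      rw [← hpre]; exact hpres.measurable hE
    have hE'v : volume E' = ENNReal.ofReal e := by
      rw [← hpre, hpres.measure_preimage hE.nullMeasurableSet, hEe]
    have hd1 : (0 : ℝ) < d + 1 := by positivity
    set θ : ℝ := d / (d + 1) * e with hθ
    have hθ0 : 0 ≤ θ := by positivity
    set F : Set (AddCircle (1 : ℝ)) :=
      {x | ENNReal.ofReal θ < volume (Prod.mk x ⁻¹' E')} with hF
    have hsm : Measurable fun x => volume (Prod.mk x ⁻¹' E') := measurable_measure_prodMk_left hE'm
    have hFm : MeasurableSet F := measurableSet_lt measurable_const hsm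
    have hFv : e / (d + 1) ≤ (volume F).toReal := by
      have h1 : ENNReal.ofReal e ≤ volume F + ENNReal.ofReal θ := by
        rw [← hE'v]
        calc volume E' = ∫⁻ x, volume (Prod.mk x ⁻¹' E') := Measure.prod_apply hE'm
          _ ≤ ∫⁻ x, (F.indicator (fun _ => 1) x + ENNReal.ofReal θ) := by
              apply lintegral_mono
              intro x
              by_cases hx : x ∈ F
              · simp only [Set.indicator_of_mem hx]
                refine le_trans ?_ le_self_add
                calc volume (Prod.mk x ⁻¹' E') ≤ volume Set.univ := measure_mono (Set.subset_univ _)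
                  _ = 1 := measure_univ
              · simp only [Set.indicator_of_notMem hx, zero_add]
                exact not_lt.1 hx
          _ = volume F + ENNReal.ofReal θ := by
              rw [lintegral_add_right _ measurable_const, lintegral_indicator_const hFm,
                lintegral_const, measure_univ, one_mul, mul_one]
      have h2 : e ≤ (volume F).toReal + θ := by
        have h3 : volume F = ENNReal.ofReal (volume F).toReal :=
          (ENNReal.ofReal_toReal (measure_ne_top _ _)).symm
        rw [h3, ← ENNReal.ofReal_add ENNReal.toReal_nonneg hθ0] at h1
        exact (ENNReal.ofReal_le_ofReal_iff (by positivity)).1 h1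
      have h4 : e / (d + 1) = e - θ := by rw [hθ]; field_simp; ring
      linarith
    have hF0 : 0 < volume F := by
      have : 0 < (volume F).toReal := lt_of_lt_of_le (by positivity) hFv
      exact (ENNReal.toReal_pos_iff.1 this).1
    set Q : ℝ := 14 * (d + 1 : ℕ) / e with hQ
    have hQ0 : 0 ≤ Q := by positivity
    have hslice : ∀ x ∈ F, ∀ y, ‖p (Fin.cons x y)‖ ≤ Q ^ (∑ i : Fin d, m i.succ) * B := by
      intro x hx y
      have hx' : ENNReal.ofReal θ < volume (Prod.mk x ⁻¹' E') := hx
      have hpos : 0 < volume (Prod.mk x ⁻¹' E') := lt_of_le_of_lt (by positivity) hx'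
      have h := ih (fun i => m i.succ)
        (fun k' => ∑ k0 : Fin (m 0 + 1), c (Fin.cons k0 k') * fourier (r 0 k0) x)
        (fun i => r i.succ) (Prod.mk x ⁻¹' E') (measurable_prodMk_left hE'm) hpos B
        (by
          intro s hs
          rw [← hp2 x s]
          exact hB _ hs) y
      rw [← hp2 x y] at h
      refine h.trans ?_
      apply mul_le_mul_of_nonneg_right _ hB0
      apply pow_le_pow_left₀ (by positivity)
      set v := (volume (Prod.mk x ⁻¹' E')).toReal with hv
      have hv0 : 0 < v := ENNReal.toReal_pos hpos.ne' (measure_ne_top _ _)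
      have hθv : θ ≤ v := by
        have := (ENNReal.ofReal_lt_iff_lt_toReal hθ0 (measure_ne_top _ _)).1 hx'
        exact this.le
      rw [hQ, div_le_div_iff₀ hv0 he0]
      have h5 : d * e = (d + 1) * θ := by rw [hθ]; field_simp
      push_cast
      nlinarith
    have hfin : ∀ x y, ‖p (Fin.cons x y)‖ ≤ Q ^ (m 0) * (Q ^ (∑ i : Fin d, m i.succ) * B) := by
      intro x y
      have h := turan_one (m 0) (fun k0 => ∑ k' : ∀ i : Fin d, Fin (m i.succ + 1),
          c (Fin.cons k0 k') * ∏ i, fourier (r i.succ (k' i)) (y i)) (r 0) F hFm hF0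
          (Q ^ (∑ i : Fin d, m i.succ) * B)
          (by
            intro s hs
            rw [← hp1 s y]
            exact hslice s hs y) x
      rw [← hp1 x y] at h
      refine h.trans ?_
      apply mul_le_mul_of_nonneg_right _ (by positivity)
      apply pow_le_pow_left₀ (by positivity)
      rw [hQ]
      have h6 : 14 / (volume F).toReal ≤ 14 / (e / (d + 1)) := by
        apply div_le_div_of_nonneg_left (by norm_num) (by positivity) hFv
      refine h6.trans (le_of_eq ?_)
      push_cast
      field_simp
    have := hfin (t 0) (fun i => t i.succ)
    have ht : (Fin.cons (t 0) (fun i => t i.succ) : Fin (d + 1) → AddCircle (1 : ℝ)) = t := by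
      exact Fin.cons_self_tail t
    rw [ht] at this
    rw [Fin.sum_univ_succ, pow_add, mul_assoc]
    exact this

/-- **Fontes-Merz's Turán Lemma**: let
`p(z₁,…,z_d) = ∑_{k₁=0}^{m₁} ⋯ ∑_{k_d=0}^{m_d} c_{k₁,…,k_d} z₁^{r_{1,k₁}} ⋯ z_d^{r_{d,k_d}}`
be a polynomial in `d` variables with integer exponents, viewed as a function on the torus
`𝕋^d`.  For every measurable `E ⊆ 𝕋^d` of positive measure,
`sup_{𝕋^d} |p| ≤ (14 d / |E|)^{m₁+⋯+m_d} sup_E |p|`. -/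
theorem fontes_merz_turan (d : ℕ) (hd : 1 ≤ d) (m : Fin d → ℕ)
    (c : (∀ i, Fin (m i + 1)) → ℂ) (r : ∀ i : Fin d, Fin (m i + 1) → ℤ)
    (E : Set (∀ _ : Fin d, AddCircle (1 : ℝ))) (hE : MeasurableSet E)
    (hE0 : 0 < volume E) (t : ∀ _ : Fin d, AddCircle (1 : ℝ)) :
    ‖∑ k : ∀ i, Fin (m i + 1), c k * ∏ i, fourier (r i (k i)) (t i)‖ ≤
      (14 * d / (volume E).toReal) ^ (∑ i, m i) *
        ⨆ s : E,
          ‖∑ k : ∀ i, Fin (m i + 1),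
            c k * ∏ i, fourier (r i (k i)) ((s : ∀ _ : Fin d, AddCircle (1 : ℝ)) i)‖ := by
  have hbdd : BddAbove (Set.range fun s : E => ‖∑ k : ∀ i, Fin (m i + 1),
      c k * ∏ i, fourier (r i (k i)) ((s : ∀ _ : Fin d, AddCircle (1 : ℝ)) i)‖) := by
    refine ⟨∑ k, ‖c k‖, ?_⟩
    rintro _ ⟨s, rfl⟩
    refine (norm_sum_le _ _).trans (le_of_eq ?_)
    refine Finset.sum_congr rfl fun k _ => ?_
    rw [norm_mul, norm_prod, Finset.prod_eq_one, mul_one]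
    intro i _
    rw [fourier_zz, norm_zpow, norm_zz, one_zpow]
  exact turan_multi d m c r E hE hE0 _ (fun s hs => le_ciSup hbdd ⟨s, hs⟩) t
end
end
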